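/- arXiv:2512.04417 — 14 statements merged into one kernel-verified Lean document; each statement's English description precedes it below -/
import Mathlib

section
/- If n is an integer with |n| > 1 that has at least two distinct prime factors, then there exists a finite set S ⊆ ℤ with cardinality at most τ(|n|) − 2 (where τ is the number-of-divisors function) such that n is S-perfect. -/
/-- The positive divisors of `n` strictly between `1` and `|n|`,
i.e. the divisors `d_1 < ⋯ < d_k` in `1 = d_0 < d_1 < ⋯ < d_k < d_{k+1} = |n|`. -/
def midDivisors (n : ℤ) : Finset ℕ :=
  n.natAbs.divisors.filter (fun d => 1 < d ∧ d < n.natAbs)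

/-- An integer `n` with `|n| > 1` is `S`-perfect (of the first kind) if
`n = 1 + ∑_{j=1}^k λ_j d_j` for some coefficients `λ_j ∈ S`. -/
def IsSPerfect (S : Set ℤ) (n : ℤ) : Prop :=
  1 < n.natAbs ∧ ∃ lam : ℕ → ℤ,
    (∀ d ∈ midDivisors n, lam d ∈ S) ∧
    n = 1 + ∑ d ∈ midDivisors n, lam d * (d : ℤ)

theorem card_midDivisors_le (n : ℤ) (hn : 1 < n.natAbs) :
    (midDivisors n).card ≤ n.natAbs.divisors.card - 2 := by
  have hsub : ({1, n.natAbs} : Finset ℕ) ⊆ n.natAbs.divisors := by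
    intro d hd
    simp only [Finset.mem_insert, Finset.mem_singleton] at hd
    rw [Nat.mem_divisors]
    rcases hd with rfl | rfl
    · exact ⟨one_dvd _, by omega⟩
    · exact ⟨dvd_rfl, by omega⟩
  rw [← Finset.card_pair hn.ne, ← Finset.card_sdiff_of_subset hsub]
  refine Finset.card_le_card fun d hd => ?_
  simp only [midDivisors, Finset.mem_filter] at hd
  simp only [Finset.mem_sdiff, Finset.mem_insert, Finset.mem_singleton]
  exact ⟨hd.1, by omega⟩

theorem exists_finset_isSPerfect_of_isCoprime {n : ℤ} (hn : 1 < n.natAbs) {p q : ℕ}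
    (hp : p ∈ midDivisors n) (hq : q ∈ midDivisors n)
    (hco : IsCoprime (p : ℤ) (q : ℤ)) :
    ∃ S : Finset ℤ, S.card ≤ n.natAbs.divisors.card - 2 ∧ IsSPerfect ↑S n := by
  obtain ⟨a, b, hab⟩ := hco
  let lam : ℕ → ℤ := fun d =>
    (if d = p then a * (n - 1) else 0) + (if d = q then b * (n - 1) else 0)
  refine ⟨(midDivisors n).image lam, Finset.card_image_le.trans (card_midDivisors_le n hn), hn,
    lam, fun d hd => Finset.mem_coe.2 (Finset.mem_image_of_mem lam hd), ?_⟩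
  simp only [lam, add_mul, ite_mul, zero_mul, Finset.sum_add_distrib, Finset.sum_ite_eq', hp, hq,
    if_true]
  linear_combination (1 - n) * hab

theorem prime_mem_midDivisors {n : ℤ} (hn : 1 < n.natAbs) {p q : ℕ} (hp : p.Prime)
    (hq : q.Prime) (hpq : p ≠ q) (hpn : (p : ℤ) ∣ n) (hqn : (q : ℤ) ∣ n) :
    p ∈ midDivisors n := by
  have hp' : p ∣ n.natAbs := Int.natCast_dvd.1 hpn
  have hq' : q ∣ n.natAbs := Int.natCast_dvd.1 hqn
  simp only [midDivisors, Finset.mem_filter, Nat.mem_divisors]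
  refine ⟨⟨hp', by omega⟩, hp.one_lt, lt_of_le_of_ne (Nat.le_of_dvd (by omega) hp') ?_⟩
  intro hpe
  rw [← hpe] at hq'
  exact hpq ((Nat.prime_dvd_prime_iff_eq hq hp).1 hq').symm

theorem stmt0 (n : ℤ) (hn : 1 < n.natAbs)
    (h : ∃ p q : ℕ, p.Prime ∧ q.Prime ∧ p ≠ q ∧ (p : ℤ) ∣ n ∧ (q : ℤ) ∣ n) :
    ∃ S : Finset ℤ, S.card ≤ n.natAbs.divisors.card - 2 ∧ IsSPerfect ↑S n := by
  obtain ⟨p, q, hp, hq, hpq, hpn, hqn⟩ := h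
  exact exists_finset_isSPerfect_of_isCoprime hn (prime_mem_midDivisors hn hp hq hpq hpn hqn)
    (prime_mem_midDivisors hn hq hp hpq.symm hqn hpn)
    (Nat.isCoprime_iff_coprime.2 ((Nat.coprime_primes hp hq).2 hpq))
end

section
/- Let m ≥ 1. If n is a {0, m}-perfect number, then (m+1)·n is also a {0, m}-perfect number. -/
theorem mem_midDivisors {n : ℤ} {d : ℕ} :
    d ∈ midDivisors n ↔ d ∣ n.natAbs ∧ 1 < d ∧ d < n.natAbs := by
  simp only [midDivisors, Finset.mem_filter, Nat.mem_divisors]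
  constructor
  · rintro ⟨⟨h, -⟩, h'⟩
    exact ⟨h, h'⟩
  · rintro ⟨h, h'⟩
    exact ⟨⟨h, by omega⟩, h'⟩

theorem insert_natAbs_midDivisors_subset {a n : ℤ} (ha : 1 < a.natAbs) (hn : 1 < n.natAbs) :
    insert n.natAbs (midDivisors n) ⊆ midDivisors (a * n) := by
  have hlt : n.natAbs < (a * n).natAbs := by
    rw [Int.natAbs_mul]
    exact lt_mul_of_one_lt_left (by omega) ha
  have hdvd : n.natAbs ∣ (a * n).natAbs := Int.natAbs_mul a n ▸ Nat.dvd_mul_left _ _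
  intro d hd
  rw [mem_midDivisors]
  rcases Finset.mem_insert.1 hd with rfl | hd
  · exact ⟨hdvd, hn, hlt⟩
  · obtain ⟨h₁, h₂, h₃⟩ := mem_midDivisors.1 hd
    exact ⟨h₁.trans hdvd, h₂, h₃.trans hlt⟩

theorem IsSPerfect.one_lt {S : Set ℤ} {n : ℤ} (h : IsSPerfect S n) (hS : ∀ s ∈ S, 0 ≤ s) :
    1 < n := by
  obtain ⟨hn, lam, hlam, hsum⟩ := h
  have : 0 ≤ ∑ d ∈ midDivisors n, lam d * (d : ℤ) :=
    Finset.sum_nonneg fun d hd => mul_nonneg (hS _ (hlam d hd)) (Int.natCast_nonneg d)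
  omega

theorem stmt4 (m : ℤ) (hm : 1 ≤ m) (n : ℤ) (h : IsSPerfect {0, m} n) :
    IsSPerfect {0, m} ((m + 1) * n) := by
  have hn1 : 1 < n := h.one_lt (by rintro s (rfl | rfl) <;> omega)
  obtain ⟨hn, lam, hlam, hsum⟩ := h
  have hnot : n.natAbs ∉ midDivisors n := fun h => (mem_midDivisors.1 h).2.2.false
  have hsub := insert_natAbs_midDivisors_subset (a := m + 1) (by omega) hn
  refine ⟨hn.trans (mem_midDivisors.1 (hsub (Finset.mem_insert_self _ _))).2.2, fun d =>
    if d = n.natAbs then m else if d ∈ midDivisors n then lam d else 0, ?_, ?_⟩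
  · intro d _
    dsimp only
    split_ifs with h₁ h₂
    · simp
    · exact hlam d h₂
    · simp
  · rw [← Finset.sum_subset hsub, Finset.sum_insert hnot]
    · have hcongr : ∑ d ∈ midDivisors n,
          (if d = n.natAbs then m else if d ∈ midDivisors n then lam d else 0) * (d : ℤ) =
          ∑ d ∈ midDivisors n, lam d * (d : ℤ) :=
        Finset.sum_congr rfl fun d hd => by
          rw [if_neg (ne_of_mem_of_not_mem hd hnot), if_pos hd]
      dsimp only
      rw [hcongr, if_pos rfl, Int.natAbs_of_nonneg (by omega)]
      linarith
    · intro d _ hd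
      rw [Finset.mem_insert, not_or] at hd
      dsimp only
      rw [if_neg hd.1, if_neg hd.2, zero_mul]
end

section
/- For every integer m ≥ 1, there exist infinitely many positive {0, m}-perfect numbers. -/
theorem isSPerfect_of_subset_midDivisors {m n : ℕ} (hn : 1 < n) {s : Finset ℕ}
    (hs : s ⊆ midDivisors n) (h : n = 1 + m * ∑ d ∈ s, d) :
    IsSPerfect {0, (m : ℤ)} n := by
  refine ⟨by simpa using hn, fun d => if d ∈ s then (m : ℤ) else 0, fun d _ => ?_, ?_⟩
  · by_cases hd : d ∈ s <;> simp [hd]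
  · simp only [ite_mul, zero_mul, Finset.sum_ite_mem, Finset.inter_eq_right.2 hs]
    rw [← Finset.mul_sum]
    have hcast := congrArg (Nat.cast : ℕ → ℤ) h
    push_cast at hcast
    exact hcast

/-- If `n = 1 + m * ∑ d ∈ s, d` for a set `s` of proper divisors of `n`, then `n * (1 + m * n)` has
the same shape, with all divisors used being larger than `1`. -/
theorem exists_subset_midDivisors_mul {m n : ℕ} (hm : 1 ≤ m) (hn : 1 < n) {s : Finset ℕ}
    (hs : s ⊆ n.properDivisors) (h : n = 1 + m * ∑ d ∈ s, d) :
    ∃ t ⊆ midDivisors (n * (1 + m * n) : ℕ), n * (1 + m * n) = 1 + m * ∑ d ∈ t, d := by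
  have hq : n < 1 + m * n := by nlinarith
  have hpos : ∀ d ∈ s, 0 < d := fun d hd => Nat.pos_of_mem_properDivisors (hs hd)
  refine ⟨insert n (s.image (· * (1 + m * n))), fun d hd => ?_, ?_⟩
  · simp only [midDivisors, Int.natAbs_natCast, Finset.mem_filter, Nat.mem_divisors]
    rcases Finset.mem_insert.1 hd with rfl | hd
    · exact ⟨⟨dvd_mul_right _ _, by positivity⟩, hn, by nlinarith⟩
    · obtain ⟨e, he, rfl⟩ := Finset.mem_image.1 hd
      obtain ⟨hdvd, hlt⟩ := Nat.mem_properDivisors.1 (hs he)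
      have := hpos e he
      exact ⟨⟨Nat.mul_dvd_mul_right hdvd _, by positivity⟩, by nlinarith,
        Nat.mul_lt_mul_of_pos_right hlt (by omega)⟩
  · have hnot : n ∉ s.image (· * (1 + m * n)) := by
      intro hmem
      obtain ⟨e, he, heq⟩ := Finset.mem_image.1 hmem
      have := hpos e he
      nlinarith
    rw [Finset.sum_insert hnot, Finset.sum_image
      fun a _ b _ hab => Nat.eq_of_mul_eq_mul_right (by omega) hab, ← Finset.sum_mul]
    generalize ∑ d ∈ s, d = S at h
    linear_combination (1 + m * n) * h

theorem exists_gt_subset_properDivisors {m : ℕ} (hm : 1 ≤ m) (k : ℕ) :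
    ∃ n, k < n ∧ 1 < n ∧ ∃ s ⊆ n.properDivisors, n = 1 + m * ∑ d ∈ s, d := by
  induction k with
  | zero =>
    refine ⟨1 + m, by omega, by omega, {1}, ?_, by simp⟩
    simpa [Nat.pos_iff_ne_zero, Nat.one_le_iff_ne_zero] using hm
  | succ k ih =>
    obtain ⟨n, hk, hn, s, hs, h⟩ := ih
    obtain ⟨t, ht, h'⟩ := exists_subset_midDivisors_mul hm hn hs h
    have hlt : n < n * (1 + m * n) := by nlinarith [Nat.mul_le_mul hm hn.le]
    refine ⟨n * (1 + m * n), by omega, by omega, t, fun d hd => ?_, h'⟩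
    have := ht hd
    simp only [midDivisors, Int.natAbs_natCast, Finset.mem_filter, Nat.mem_divisors] at this
    exact Nat.mem_properDivisors.2 ⟨this.1.1, this.2.2⟩

theorem stmt5 (m : ℤ) (hm : 1 ≤ m) :
    {n : ℤ | 0 < n ∧ IsSPerfect {0, m} n}.Infinite := by
  lift m to ℕ using by omega
  have hm' : 1 ≤ m := by exact_mod_cast hm
  refine Set.infinite_of_forall_exists_gt fun a => ?_
  obtain ⟨n, hk, hn, s, hs, h⟩ := exists_gt_subset_properDivisors hm' a.natAbs
  obtain ⟨t, ht, h'⟩ := exists_subset_midDivisors_mul hm' hn hs h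
  have hlt : n < n * (1 + m * n) := by nlinarith [Nat.mul_le_mul hm' hn.le]
  refine ⟨(n * (1 + m * n) : ℕ), ⟨by omega, ?_⟩, by omega⟩
  exact isSPerfect_of_subset_midDivisors (by omega) ht h'
end

section
/- Let m ≥ 1 and 0 ≤ s ≤ t be integers. An integer n can be written as n = Σ_{j=s}^{t} λ_j·2^j with each λ_j ∈ {−1, m} if and only if n ≡ −2^s(2^{t−s+1} − 1) (mod 2^s(m+1)) and −2^s(2^{t−s+1} − 1) ≤ n ≤ 2^s·m·(2^{t−s+1} − 1). -/
/-- Sums of `L` consecutive powers of two with coefficients in `{-1, m}`, starting at `2 ^ s`, are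
parametrized by the integers `0 ≤ k < 2 ^ L` whose binary digits select the coefficients `m`. -/
theorem exists_sum_two_pow_iff (m : ℤ) (s L : ℕ) (n : ℤ) :
    (∃ lam : ℕ → ℤ, (∀ j ∈ Finset.Ico s (s + L), lam j ∈ ({-1, m} : Set ℤ)) ∧
        n = ∑ j ∈ Finset.Ico s (s + L), lam j * 2 ^ j) ↔
      ∃ k : ℤ, 0 ≤ k ∧ k < 2 ^ L ∧ n = 2 ^ s * ((m + 1) * k - (2 ^ L - 1)) := by
  induction L generalizing n with
  | zero =>
    constructor
    · rintro ⟨lam, -, h⟩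
      exact ⟨0, by simpa using h⟩
    · rintro ⟨k, h0, h1, h⟩
      obtain rfl : k = 0 := by rw [pow_zero] at h1; omega
      exact ⟨fun _ => 0, by simpa using h⟩
  | succ L ih =>
    constructor
    · rintro ⟨lam, hlam, h⟩
      rw [← add_assoc, Finset.sum_Ico_succ_top (by omega)] at h
      obtain ⟨k, h0, h1, hk⟩ := (ih _).1 ⟨lam, fun j hj => hlam j (by
        simp only [Finset.mem_Ico] at hj ⊢; omega), rfl⟩
      have hpos : (0 : ℤ) < 2 ^ L := by positivity
      rw [hk, pow_add] at h
      rcases hlam (s + L) (by simp) with hl | hl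
      · refine ⟨k, h0, by rw [pow_succ]; linarith, ?_⟩
        rw [h, hl]; ring
      · refine ⟨k + 2 ^ L, by linarith, by rw [pow_succ]; linarith, ?_⟩
        rw [h, Set.mem_singleton_iff.1 hl]; ring
    · rintro ⟨k, h0, h1, h⟩
      have key : ∀ c ∈ ({-1, m} : Set ℤ), ∀ k' : ℤ, 0 ≤ k' → k' < 2 ^ L →
          n = 2 ^ s * ((m + 1) * k' - (2 ^ L - 1)) + c * 2 ^ (s + L) →
          ∃ lam : ℕ → ℤ, (∀ j ∈ Finset.Ico s (s + (L + 1)), lam j ∈ ({-1, m} : Set ℤ)) ∧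
            n = ∑ j ∈ Finset.Ico s (s + (L + 1)), lam j * 2 ^ j := by
        intro c hc k' h0' h1' hn
        obtain ⟨lam, hlam, hsum⟩ := (ih _).2 ⟨k', h0', h1', rfl⟩
        refine ⟨fun j => if j = s + L then c else lam j, fun j hj => ?_, ?_⟩
        · dsimp only
          split_ifs with hj'
          · exact hc
          · exact hlam j (by simp only [Finset.mem_Ico] at hj ⊢; omega)
        · rw [← add_assoc, Finset.sum_Ico_succ_top (by omega), hn, hsum]
          simp only [if_true]
          congr 1
          refine Finset.sum_congr rfl fun j hj => ?_
          rw [if_neg (Finset.mem_Ico.1 hj).2.ne]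
      rw [pow_succ] at h1
      rcases lt_or_ge k (2 ^ L) with hk | hk
      · exact key (-1) (by simp) k h0 hk (by rw [h]; ring)
      · exact key m (by simp) (k - 2 ^ L) (by linarith) (by linarith) (by rw [h]; ring)

theorem stmt7 (m : ℤ) (hm : 1 ≤ m) (s t : ℕ) (hst : s ≤ t) (n : ℤ) :
    (∃ lam : ℕ → ℤ, (∀ j ∈ Finset.Icc s t, lam j ∈ ({-1, m} : Set ℤ)) ∧
        n = ∑ j ∈ Finset.Icc s t, lam j * 2 ^ j) ↔
      (n ≡ -2 ^ s * (2 ^ (t - s + 1) - 1) [ZMOD 2 ^ s * (m + 1)] ∧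
        -2 ^ s * (2 ^ (t - s + 1) - 1) ≤ n ∧ n ≤ 2 ^ s * m * (2 ^ (t - s + 1) - 1)) := by
  have hIcc : Finset.Icc s t = Finset.Ico s (s + (t - s + 1)) := by
    ext j
    simp only [Finset.mem_Icc, Finset.mem_Ico]
    omega
  rw [hIcc, exists_sum_two_pow_iff]
  generalize t - s + 1 = L
  have hs : (0 : ℤ) < 2 ^ s := by positivity
  have hc : (0 : ℤ) < 2 ^ s * (m + 1) := by positivity
  constructor
  · rintro ⟨k, h0, h1, rfl⟩
    refine ⟨(Int.modEq_iff_dvd.2 ⟨k, by ring⟩).symm, ?_, ?_⟩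
    · linarith [mul_nonneg hc.le h0]
    · linarith [mul_le_mul_of_nonneg_left (Int.le_sub_one_of_lt h1) hc.le]
  · rintro ⟨h, hl, hu⟩
    obtain ⟨k, hk⟩ := Int.modEq_iff_dvd.1 h.symm
    refine ⟨k, ?_, ?_, by linarith⟩
    · exact nonneg_of_mul_nonneg_right (by linarith) hc
    · refine Int.lt_of_le_sub_one (le_of_mul_le_mul_left ?_ hc)
      linarith
end

section
/- Fix an integer m ≥ 1 and set β = ν₂(m+1), the 2-adic valuation of m+1. Let 0 ≤ s ≤ t with t ≥ s + β − 1, and let α ≥ 1 satisfy 2^α ≡ 1 (mod (m+1)/2^β). If n = Σ_{j=s}^{t} λ_j·2^j for some λ_s, …, λ_t ∈ {−1, m}, then there exist Λ_s, …, Λ_{t+α} ∈ {−1, m} with n = Σ_{j=s}^{t+α} Λ_j·2^j. -/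
/-- The sums `∑ λ_j 2^j` over `s ≤ j < s + N` with `λ_j ∈ {-1, m}` are the numbers
`2^s ((m + 1) A - (2^N - 1))` with `0 ≤ A < 2^N`. -/
theorem exists_eq_sum_neg_one_or_iff (m n : ℤ) (s N : ℕ) :
    (∃ lam : ℕ → ℤ, (∀ j ∈ Finset.Ico s (s + N), lam j ∈ ({-1, m} : Set ℤ)) ∧
      n = ∑ j ∈ Finset.Ico s (s + N), lam j * 2 ^ j) ↔
    ∃ A : ℤ, 0 ≤ A ∧ A < 2 ^ N ∧ n = 2 ^ s * ((m + 1) * A - (2 ^ N - 1)) := by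
  induction N generalizing n with
  | zero =>
    constructor
    · rintro ⟨lam, -, h⟩
      exact ⟨0, by simp_all⟩
    · rintro ⟨A, h0, h1, h⟩
      obtain rfl : A = 0 := by
        rw [pow_zero] at h1
        omega
      exact ⟨fun _ => -1, by simp_all⟩
  | succ N ih =>
    rw [← add_assoc]
    constructor
    · rintro ⟨lam, hlam, h⟩
      rw [Finset.sum_Ico_succ_top (by omega)] at h
      obtain ⟨A, h0, h1, hA⟩ := (ih _).1 ⟨lam, fun j hj => hlam j (by
        rw [Finset.mem_Ico] at hj ⊢
        omega), rfl⟩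
      have hpow : (2 : ℤ) ^ (N + 1) = 2 * 2 ^ N := pow_succ' 2 N
      rcases hlam (s + N) (by simp) with hl | hl
      · refine ⟨A, h0, by linarith, ?_⟩
        rw [h, hA, hl]
        ring
      · rw [Set.mem_singleton_iff] at hl
        refine ⟨A + 2 ^ N, by positivity, by linarith, ?_⟩
        rw [h, hA, hl]
        ring
    · rintro ⟨A, h0, h1, h⟩
      have hpow : (2 : ℤ) ^ (N + 1) = 2 * 2 ^ N := pow_succ' 2 N
      obtain ⟨c, hc, A', hA0, hA1, hA⟩ : ∃ c ∈ ({-1, m} : Set ℤ), ∃ A' : ℤ, 0 ≤ A' ∧ A' < 2 ^ N ∧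
          n - c * 2 ^ (s + N) = 2 ^ s * ((m + 1) * A' - (2 ^ N - 1)) := by
        rcases lt_or_ge A (2 ^ N) with hlt | hge
        · refine ⟨-1, by simp, A, h0, hlt, ?_⟩
          rw [h]
          ring
        · refine ⟨m, by simp, A - 2 ^ N, by linarith, by linarith, ?_⟩
          rw [h]
          ring
      obtain ⟨lam, hlam, hsum⟩ := (ih _).2 ⟨A', hA0, hA1, hA⟩
      refine ⟨Function.update lam (s + N) c, fun j hj => ?_, ?_⟩
      · rcases eq_or_ne j (s + N) with rfl | hne
        · simpa using hc
        · rw [Function.update_of_ne hne]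
          refine hlam j ?_
          rw [Finset.mem_Ico] at hj ⊢
          omega
      · rw [Finset.sum_Ico_succ_top (by omega), Function.update_self]
        have hcongr : ∑ j ∈ Finset.Ico s (s + N), Function.update lam (s + N) c j * 2 ^ j =
            ∑ j ∈ Finset.Ico s (s + N), lam j * 2 ^ j := by
          refine Finset.sum_congr rfl fun j hj => ?_
          rw [Function.update_of_ne (Finset.mem_Ico.1 hj).2.ne]
        rw [hcongr, ← hsum]
        ring

theorem stmt8 (m : ℤ) (hm : 1 ≤ m) (β : ℕ)
    (hβ : (2 : ℤ) ^ β ∣ m + 1) (hβ' : ¬ (2 : ℤ) ^ (β + 1) ∣ m + 1)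
    (s t α : ℕ) (hst : s ≤ t) (ht : s + β ≤ t + 1) (hα : 1 ≤ α)
    (hmod : (2 : ℤ) ^ α ≡ 1 [ZMOD (m + 1) / 2 ^ β])
    (n : ℤ) (lam : ℕ → ℤ)
    (hlam : ∀ j ∈ Finset.Icc s t, lam j ∈ ({-1, m} : Set ℤ))
    (hn : n = ∑ j ∈ Finset.Icc s t, lam j * 2 ^ j) :
    ∃ Lam : ℕ → ℤ, (∀ j ∈ Finset.Icc s (t + α), Lam j ∈ ({-1, m} : Set ℤ)) ∧
      n = ∑ j ∈ Finset.Icc s (t + α), Lam j * 2 ^ j := by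
  have hIcc (k : ℕ) : Finset.Icc s (t + k) = Finset.Ico s (s + (t + 1 - s + k)) := by
    ext j
    rw [Finset.mem_Icc, Finset.mem_Ico]
    omega
  rw [hIcc α, exists_eq_sum_neg_one_or_iff]
  have hIcc0 := hIcc 0
  rw [add_zero, add_zero] at hIcc0
  rw [hIcc0] at hlam hn
  obtain ⟨A, hA0, hA1, hA⟩ := (exists_eq_sum_neg_one_or_iff m n s _).1 ⟨lam, hlam, hn⟩
  obtain ⟨r, hr⟩ : ∃ r, t + 1 - s = β + r := ⟨t + 1 - s - β, by omega⟩
  rw [hr] at hA1 hA ⊢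
  obtain ⟨q, hq⟩ := hβ
  rw [hq, Int.mul_ediv_cancel_left _ (by positivity)] at hmod
  obtain ⟨c, hc⟩ := hmod.symm.dvd
  have hshift : (m + 1) * (2 ^ r * c) = 2 ^ (β + r) * (2 ^ α - 1) := by
    rw [hq, hc]
    ring
  have hpow : (1 : ℤ) ≤ 2 ^ α := one_le_pow₀ (by norm_num)
  have hnonneg : 0 ≤ 2 ^ r * c := by
    refine nonneg_of_mul_nonneg_right (a := m + 1) ?_ (by linarith)
    rw [hshift]
    exact mul_nonneg (by positivity) (by linarith)
  have hle : 2 ^ r * c ≤ 2 ^ (β + r) * (2 ^ α - 1) := by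
    rw [← hshift]
    exact le_mul_of_one_le_left hnonneg (by linarith)
  refine ⟨A + 2 ^ r * c, by linarith, ?_, ?_⟩
  · rw [pow_add 2 (β + r) α]
    linarith
  · rw [hA, mul_add (m + 1), hshift]
    ring
end

section
/- Fix an integer m ≥ 1 and set β = ν₂(m+1). If both 2^k·p and 2^{k+α}·p are {−1, m}-perfect for some odd prime p and integers k, α ≥ 1, then 2^α ≡ 1 (mod (m+1)/2^β). -/
open ArithmeticFunction in
/-- A `{-1, m}`-perfect number `n > 1` satisfies `σ(n) ≡ 2 (mod m + 1)`. -/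
theorem IsSPerfect.dvd_sigma_sub_two {m : ℤ} {n : ℕ} (h : IsSPerfect {-1, m} (n : ℤ)) :
    m + 1 ∣ (sigma 1 n : ℤ) - 2 := by
  obtain ⟨hn, lam, hlam, hsum⟩ := h
  rw [Int.natAbs_natCast] at hn
  have hdiv : n.divisors = insert 1 (insert n (midDivisors n)) := by
    ext d
    simp only [midDivisors, Int.natAbs_natCast, Finset.mem_insert, Finset.mem_filter,
      Nat.mem_divisors]
    constructor
    · rintro ⟨hd, h0⟩
      have := Nat.le_of_dvd (by omega) hd
      have := Nat.pos_of_dvd_of_pos hd (by omega)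
      have : d = 1 ∨ d = n ∨ (1 < d ∧ d < n) := by omega
      tauto
    · rintro (rfl | rfl | h)
      · exact ⟨one_dvd _, by omega⟩
      · exact ⟨dvd_rfl, by omega⟩
      · exact h.1
  have hsigma : (sigma 1 n : ℤ) = 1 + (n + ∑ d ∈ midDivisors n, (d : ℤ)) := by
    rw [sigma_one_apply, hdiv, Finset.sum_insert, Finset.sum_insert]
    · push_cast
      rfl
    · simp [midDivisors]
    · simp [midDivisors, hn.ne]
  have hmid : m + 1 ∣ ∑ d ∈ midDivisors n, (lam d + 1) * (d : ℤ) := by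
    refine Finset.dvd_sum fun d hd => Dvd.dvd.mul_right ?_ _
    rcases hlam d hd with h | h
    · simp [h]
    · rw [h]
  simp only [add_mul, one_mul, Finset.sum_add_distrib] at hmid
  convert hmid using 1
  linarith

open ArithmeticFunction in
theorem sigma_one_two_pow_mul_prime {p : ℕ} (hp : p.Prime) (hpodd : Odd p) (k : ℕ) :
    (sigma 1 (2 ^ k * p) : ℤ) = (2 ^ (k + 1) - 1) * (p + 1) := by
  have hcop : Nat.Coprime (2 ^ k) p := (Nat.coprime_two_left.mpr hpodd).pow_left k
  rw [isMultiplicative_sigma.map_mul_of_coprime hcop, sigma_one_apply, sigma_one_apply,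
    Nat.sum_divisors_prime_pow Nat.prime_two, hp.sum_divisors]
  have := mul_geom_sum (2 : ℤ) (k + 1)
  push_cast
  rw [← this]
  ring

theorem stmt9 (m : ℤ) (hm : 1 ≤ m) (β : ℕ)
    (hβ : (2 : ℤ) ^ β ∣ m + 1) (hβ' : ¬ (2 : ℤ) ^ (β + 1) ∣ m + 1)
    (p : ℕ) (hp : p.Prime) (hpodd : Odd p) (k α : ℕ) (hk : 1 ≤ k) (hα : 1 ≤ α)
    (h1 : IsSPerfect {-1, m} ((2 : ℤ) ^ k * p))
    (h2 : IsSPerfect {-1, m} ((2 : ℤ) ^ (k + α) * p)) :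
    (2 : ℤ) ^ α ≡ 1 [ZMOD (m + 1) / 2 ^ β] := by
  obtain ⟨M, hM⟩ := hβ
  have hquot : (m + 1) / 2 ^ β = M := by
    rw [hM]
    exact Int.mul_ediv_cancel_left _ (by positivity)
  have hMm : M ∣ m + 1 := hM ▸ dvd_mul_left _ _
  have hMtwo : IsCoprime M 2 := by
    rw [isCoprime_comm, Int.prime_two.coprime_iff_not_dvd]
    intro h
    apply hβ'
    rw [hM, pow_succ]
    exact mul_dvd_mul_left _ h
  have key (j : ℕ) (h : IsSPerfect {-1, m} ((2 : ℤ) ^ j * p)) :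
      M ∣ (2 ^ (j + 1) - 1) * (p + 1) - 2 := by
    have h' : IsSPerfect {-1, m} ((2 ^ j * p : ℕ) : ℤ) := by
      push_cast
      exact h
    rw [← sigma_one_two_pow_mul_prime hp hpodd]
    exact hMm.trans h'.dvd_sigma_sub_two
  have hk1 := key k h1
  have hcop : IsCoprime M ((p : ℤ) + 1) := by
    obtain ⟨c, hc⟩ := hk1
    have : IsCoprime M ((2 ^ (k + 1) - 1) * ((p : ℤ) + 1)) := by
      rw [sub_eq_iff_eq_add.mp hc, add_comm]
      exact IsCoprime.add_mul_left_right hMtwo c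
    exact this.of_mul_right_right
  rw [hquot]
  refine (Int.modEq_iff_dvd.mpr ?_).symm
  have hdiff := dvd_sub (key (k + α) h2) hk1
  rw [show ((2 : ℤ) ^ (k + α + 1) - 1) * (p + 1) - 2 - ((2 ^ (k + 1) - 1) * (p + 1) - 2)
    = (p + 1) * (2 ^ (k + 1) * (2 ^ α - 1)) by ring] at hdiff
  exact hMtwo.pow_right.dvd_of_dvd_mul_left (hcop.dvd_of_dvd_mul_left hdiff)
end

section
/- Fix an integer m ≥ 1 and set β = ν₂(m+1). If 2^k·p is {−1, m}-perfect for some odd prime p and some k ≥ β, and α ≥ 1 satisfies 2^α ≡ 1 (mod (m+1)/2^β), then 2^{k+α}·p is also {−1, m}-perfect. -/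
theorem exists_sum_pow_two_eq_iff (m : ℤ) (k : ℕ) (x : ℤ) :
    (∃ f : ℕ → ℤ, (∀ i < k, f i ∈ ({-1, m} : Set ℤ)) ∧
      ∑ i ∈ Finset.range k, f i * 2 ^ i = x) ↔
    ∃ a : ℤ, 0 ≤ a ∧ a < 2 ^ k ∧ x = -(2 ^ k - 1) + (m + 1) * a := by
  induction k generalizing x with
  | zero =>
    constructor
    · rintro ⟨f, -, rfl⟩
      exact ⟨0, by simp⟩
    · rintro ⟨a, ha, ha', rfl⟩
      obtain rfl : a = 0 := by rw [pow_zero] at ha'; omega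
      exact ⟨0, by simp⟩
  | succ k ih =>
    constructor
    · rintro ⟨f, hf, rfl⟩
      obtain ⟨a, ha, ha', hx⟩ := (ih _).1 ⟨f, fun i hi => hf i (hi.trans k.lt_succ_self), rfl⟩
      rw [Finset.sum_range_succ, hx]
      have hpow : (0 : ℤ) < 2 ^ k := by positivity
      rcases hf k k.lt_succ_self with h | h
      · exact ⟨a, ha, by rw [pow_succ]; linarith, by rw [h]; ring⟩
      · rw [Set.mem_singleton_iff] at h
        exact ⟨a + 2 ^ k, by positivity, by rw [pow_succ]; linarith, by rw [h]; ring⟩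
    · rintro ⟨a, ha, ha', rfl⟩
      rw [pow_succ] at ha'
      have extend (b c : ℤ) (hb : 0 ≤ b) (hb' : b < 2 ^ k) (hc : c ∈ ({-1, m} : Set ℤ))
          (h : -(2 ^ k - 1) + (m + 1) * b + c * 2 ^ k = -(2 ^ (k + 1) - 1) + (m + 1) * a) :
          ∃ f : ℕ → ℤ, (∀ i < k + 1, f i ∈ ({-1, m} : Set ℤ)) ∧
            ∑ i ∈ Finset.range (k + 1), f i * 2 ^ i = -(2 ^ (k + 1) - 1) + (m + 1) * a := by
        obtain ⟨f, hf, hsum⟩ := (ih _).2 ⟨b, hb, hb', rfl⟩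
        refine ⟨Function.update f k c, fun i hi => ?_, ?_⟩
        · rcases (Nat.lt_succ_iff_lt_or_eq.1 hi) with hi | rfl
          · rw [Function.update_of_ne hi.ne]
            exact hf i hi
          · rwa [Function.update_self]
        · rw [Finset.sum_range_succ, Function.update_self, ← h, ← hsum]
          congr 1
          refine Finset.sum_congr rfl fun i hi => ?_
          rw [Function.update_of_ne (Finset.mem_range.1 hi).ne]
      rcases lt_or_ge a (2 ^ k) with h | h
      · exact extend a (-1) ha h (by simp) (by ring)
      · exact extend (a - 2 ^ k) m (by linarith) (by linarith) (by simp) (by ring)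

theorem mem_midDivisors_two_pow_mul_prime {p : ℕ} (hp : p.Prime) (k d : ℕ) :
    d ∈ midDivisors ((2 : ℤ) ^ k * p) ↔
      (∃ i < k, d = 2 ^ (i + 1)) ∨ ∃ i < k, d = 2 ^ i * p := by
  have hnat : ((2 : ℤ) ^ k * p).natAbs = 2 ^ k * p := by
    simp [Int.natAbs_mul, Int.natAbs_pow]
  have h2k : 0 < 2 ^ k := by positivity
  rw [midDivisors, hnat, Finset.mem_filter, Nat.mem_divisors]
  constructor
  · rintro ⟨⟨hd, -⟩, h1, hlt⟩
    obtain ⟨a, b, ha, hb, rfl⟩ := (Nat.dvd_mul).1 hd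
    obtain ⟨i, hi, rfl⟩ := (Nat.dvd_prime_pow Nat.prime_two).1 ha
    rcases (Nat.dvd_prime hp).1 hb with rfl | rfl
    · left
      cases i with
      | zero => simp at h1
      | succ i => exact ⟨i, hi, mul_one _⟩
    · right
      refine ⟨i, ?_, rfl⟩
      exact (Nat.pow_lt_pow_iff_right one_lt_two).1 (Nat.lt_of_mul_lt_mul_right hlt)
  · rintro (⟨i, hi, rfl⟩ | ⟨i, hi, rfl⟩)
    · have hle : 2 ^ (i + 1) ≤ 2 ^ k := Nat.pow_le_pow_right two_pos hi
      refine ⟨⟨(pow_dvd_pow 2 hi).mul_right p, by have := hp.pos; positivity⟩,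
        Nat.one_lt_two_pow i.succ_ne_zero, ?_⟩
      nlinarith [hp.two_le]
    · have hlt : 2 ^ i < 2 ^ k := Nat.pow_lt_pow_right one_lt_two hi
      refine ⟨⟨Nat.mul_dvd_mul_right (pow_dvd_pow 2 hi.le) p, by have := hp.pos; positivity⟩,
        ?_, Nat.mul_lt_mul_of_pos_right hlt hp.pos⟩
      nlinarith [hp.two_le, Nat.one_le_two_pow (n := i)]

theorem odd_prime_not_dvd_two_pow {p : ℕ} (hp : p.Prime) (hodd : Odd p) (i : ℕ) :
    ¬ p ∣ 2 ^ i := fun h => by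
  rw [(Nat.prime_dvd_prime_iff_eq hp Nat.prime_two).1 (hp.dvd_of_dvd_pow h)] at hodd
  exact absurd hodd (by decide)

theorem sum_midDivisors_two_pow_mul_prime {p : ℕ} (hp : p.Prime) (hodd : Odd p) (k : ℕ)
    (f : ℕ → ℤ) :
    ∑ d ∈ midDivisors ((2 : ℤ) ^ k * p), f d =
      ∑ i ∈ Finset.range k, f (2 ^ (i + 1)) + ∑ i ∈ Finset.range k, f (2 ^ i * p) := by
  have hunion : midDivisors ((2 : ℤ) ^ k * p) =
      (Finset.range k).image (fun i => 2 ^ (i + 1)) ∪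
        (Finset.range k).image (fun i => 2 ^ i * p) := by
    ext d
    simp only [mem_midDivisors_two_pow_mul_prime hp, Finset.mem_union, Finset.mem_image,
      Finset.mem_range, eq_comm]
  rw [hunion, Finset.sum_union, Finset.sum_image, Finset.sum_image]
  · intro i _ j _ h
    exact Nat.pow_right_injective le_rfl (Nat.eq_of_mul_eq_mul_right hp.pos h)
  · intro i _ j _ h
    exact Nat.succ_injective (Nat.pow_right_injective le_rfl h)
  · rw [Finset.disjoint_left]
    intro d hd hd'
    obtain ⟨i, -, rfl⟩ := Finset.mem_image.1 hd
    obtain ⟨j, -, h⟩ := Finset.mem_image.1 hd'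
    exact odd_prime_not_dvd_two_pow hp hodd (i + 1) (h ▸ dvd_mul_left p (2 ^ j))

theorem isSPerfect_two_pow_mul_prime_iff (m : ℤ) {p : ℕ} (hp : p.Prime) (hodd : Odd p) (k : ℕ) :
    IsSPerfect {-1, m} ((2 : ℤ) ^ k * p) ↔
      ∃ a b : ℤ, 0 ≤ a ∧ a < 2 ^ k ∧ 0 ≤ b ∧ b < 2 ^ k ∧
        (2 ^ (k + 1) - 1) * ((p : ℤ) + 1) - 2 = (m + 1) * (2 * a + p * b) := by
  constructor
  · rintro ⟨-, lam, hlam, hsum⟩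
    have hmem := fun d => mem_midDivisors_two_pow_mul_prime hp k d
    obtain ⟨a, ha, ha', hA⟩ := (exists_sum_pow_two_eq_iff m k _).1
      ⟨fun i => lam (2 ^ (i + 1)), fun i hi => hlam _ ((hmem _).2 (.inl ⟨i, hi, rfl⟩)), rfl⟩
    obtain ⟨b, hb, hb', hB⟩ := (exists_sum_pow_two_eq_iff m k _).1
      ⟨fun i => lam (2 ^ i * p), fun i hi => hlam _ ((hmem _).2 (.inr ⟨i, hi, rfl⟩)), rfl⟩
    refine ⟨a, b, ha, ha', hb, hb', ?_⟩
    rw [sum_midDivisors_two_pow_mul_prime hp hodd] at hsum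
    have hA2 : ∑ i ∈ Finset.range k, lam (2 ^ (i + 1)) * ((2 ^ (i + 1) : ℕ) : ℤ) =
        2 * ∑ i ∈ Finset.range k, lam (2 ^ (i + 1)) * 2 ^ i := by
      rw [Finset.mul_sum]
      exact Finset.sum_congr rfl fun i _ => by push_cast; ring
    have hB2 : ∑ i ∈ Finset.range k, lam (2 ^ i * p) * ((2 ^ i * p : ℕ) : ℤ) =
        p * ∑ i ∈ Finset.range k, lam (2 ^ i * p) * 2 ^ i := by
      rw [Finset.mul_sum]
      exact Finset.sum_congr rfl fun i _ => by push_cast; ring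
    rw [hA2, hB2, hA, hB] at hsum
    linear_combination hsum
  · rintro ⟨a, b, ha, ha', hb, hb', h⟩
    obtain ⟨f, hf, hfsum⟩ := (exists_sum_pow_two_eq_iff m k _).2 ⟨a, ha, ha', rfl⟩
    obtain ⟨g, hg, hgsum⟩ := (exists_sum_pow_two_eq_iff m k _).2 ⟨b, hb, hb', rfl⟩
    let lam : ℕ → ℤ := fun d =>
      if p ∣ d then g (Nat.log 2 (d / p)) else f (Nat.log 2 d - 1)
    have hlam_pow (i : ℕ) : lam (2 ^ (i + 1)) = f i := by
      simp only [lam, odd_prime_not_dvd_two_pow hp hodd, if_false,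
        Nat.log_pow one_lt_two, Nat.add_sub_cancel]
    have hlam_mul (i : ℕ) : lam (2 ^ i * p) = g i := by
      simp only [lam, dvd_mul_left, if_true, Nat.mul_div_cancel _ hp.pos,
        Nat.log_pow one_lt_two]
    refine ⟨?_, lam, fun d hd => ?_, ?_⟩
    · rw [Int.natAbs_mul, Int.natAbs_pow, Int.natAbs_natCast]
      exact lt_of_lt_of_le hp.one_lt (Nat.le_mul_of_pos_left p (by positivity))
    · rcases (mem_midDivisors_two_pow_mul_prime hp k d).1 hd with
        ⟨i, hi, rfl⟩ | ⟨i, hi, rfl⟩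
      · rw [hlam_pow]
        exact hf i hi
      · rw [hlam_mul]
        exact hg i hi
    · rw [sum_midDivisors_two_pow_mul_prime hp hodd]
      have hA : ∑ i ∈ Finset.range k, lam (2 ^ (i + 1)) * ((2 ^ (i + 1) : ℕ) : ℤ) =
          2 * ∑ i ∈ Finset.range k, f i * 2 ^ i := by
        rw [Finset.mul_sum]
        exact Finset.sum_congr rfl fun i _ => by rw [hlam_pow]; push_cast; ring
      have hB : ∑ i ∈ Finset.range k, lam (2 ^ i * p) * ((2 ^ i * p : ℕ) : ℤ) =
          p * ∑ i ∈ Finset.range k, g i * 2 ^ i := by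
        rw [Finset.mul_sum]
        exact Finset.sum_congr rfl fun i _ => by rw [hlam_mul]; push_cast; ring
      rw [hA, hB, hfsum, hgsum]
      linear_combination h

theorem stmt10 (m : ℤ) (hm : 1 ≤ m) (β : ℕ)
    (hβ : (2 : ℤ) ^ β ∣ m + 1) (hβ' : ¬ (2 : ℤ) ^ (β + 1) ∣ m + 1)
    (p : ℕ) (hp : p.Prime) (hpodd : Odd p) (k : ℕ) (hk : β ≤ k)
    (h1 : IsSPerfect {-1, m} ((2 : ℤ) ^ k * p))
    (α : ℕ) (hα : 1 ≤ α) (hmod : (2 : ℤ) ^ α ≡ 1 [ZMOD (m + 1) / 2 ^ β]) :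
    IsSPerfect {-1, m} ((2 : ℤ) ^ (k + α) * p) := by
  obtain ⟨a, b, ha, ha', hb, hb', h⟩ := (isSPerfect_two_pow_mul_prime_iff m hp hpodd k).1 h1
  obtain ⟨c, hc⟩ : m + 1 ∣ 2 ^ k * (2 ^ α - 1) := by
    have hdvd := mul_dvd_mul (pow_dvd_pow (2 : ℤ) hk) hmod.symm.dvd
    rwa [Int.mul_ediv_cancel' hβ] at hdvd
  have hα' : (1 : ℤ) ≤ 2 ^ α := one_le_pow₀ one_le_two
  have hc0 : 0 ≤ c := by
    have hpos : 0 ≤ (m + 1) * c := hc ▸ mul_nonneg (by positivity) (by linarith)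
    exact nonneg_of_mul_nonneg_right hpos (by linarith)
  have h2c : 2 * c ≤ 2 ^ (k + α) - 2 ^ k := by
    rw [pow_add]
    nlinarith
  exact (isSPerfect_two_pow_mul_prime_iff m hp hpodd (k + α)).2
    ⟨a + c, b + 2 * c, by linarith, by linarith, by linarith, by linarith,
      by linear_combination h + 2 * ((p : ℤ) + 1) * hc⟩
end

section
/- Fix an integer m ≥ 1 and set β = ν₂(m+1). Choose an integer α > β such that 2^α ≡ 1 (mod (m+1)/2^β). If p is a prime with p ≡ 2(2^{α+1} − 1) − 1 (mod 2(m+1)), then there exists k ≥ α such that 2^k·p is {−1, m}-perfect. -/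
theorem exists_subset_range_sum_two_pow (K N : ℕ) (hN : N < 2 ^ K) :
    ∃ s ⊆ Finset.range K, ∑ i ∈ s, 2 ^ i = N := by
  refine ⟨N.bitIndices.toFinset, fun i hi => ?_, Finset.sum_toFinset_bitIndices_two_pow N⟩
  have h : 2 ^ i ≤ N := Nat.two_pow_le_of_mem_bitIndices (List.mem_toFinset.mp hi)
  exact Finset.mem_range.mpr ((Nat.pow_lt_pow_iff_right (by norm_num)).mp (h.trans_lt hN))

theorem midDivisors_two_pow_mul_prime {p : ℕ} (hp : p.Prime) (hp2 : p ≠ 2) (k : ℕ) :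
    midDivisors ((2 : ℤ) ^ k * p) =
      (Finset.range k).image (fun i => 2 ^ (i + 1)) ∪
        (Finset.range k).image (fun i => 2 ^ i * p) := by
  have hp3 : 2 < p := lt_of_le_of_ne hp.two_le hp2.symm
  have habs : ((2 : ℤ) ^ k * p).natAbs = 2 ^ k * p := by
    simp [Int.natAbs_mul, Int.natAbs_pow]
  have hpos : 0 < 2 ^ k := by positivity
  ext d
  simp only [midDivisors, habs, Finset.mem_filter, Nat.mem_divisors, Finset.mem_union,
    Finset.mem_image, Finset.mem_range]
  constructor
  · rintro ⟨⟨hd, -⟩, h1, h2⟩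
    obtain ⟨a, b, ha, hb, rfl⟩ := exists_dvd_and_dvd_of_dvd_mul hd
    obtain ⟨i, hi, rfl⟩ := (Nat.dvd_prime_pow Nat.prime_two).mp ha
    rcases (Nat.dvd_prime hp).mp hb with rfl | rfl
    · left
      rcases i with _ | i
      · simp at h1
      · exact ⟨i, by omega, by simp⟩
    · right
      refine ⟨i, lt_of_le_of_ne hi ?_, rfl⟩
      rintro rfl
      exact lt_irrefl _ h2
  · rintro (⟨i, hi, rfl⟩ | ⟨i, hi, rfl⟩)
    · have hle : 2 ^ (i + 1) ≤ 2 ^ k := Nat.pow_le_pow_right (by norm_num) hi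
      refine ⟨⟨(pow_dvd_pow 2 hi).trans (Dvd.intro _ rfl), by positivity⟩,
        Nat.one_lt_two_pow (by omega), by nlinarith⟩
    · have hlt : 2 ^ i < 2 ^ k := Nat.pow_lt_pow_right (by norm_num) hi
      have hi1 : 0 < 2 ^ i := by positivity
      exact ⟨⟨mul_dvd_mul_right (pow_dvd_pow 2 hi.le) p, by positivity⟩,
        by nlinarith, by nlinarith⟩

theorem sum_image_two_pow_union {p : ℕ} (hp : p.Prime) (hp2 : p ≠ 2) (s t : Finset ℕ) :
    ∑ d ∈ s.image (fun i => 2 ^ (i + 1)) ∪ t.image (fun i => 2 ^ i * p), d =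
      2 * ∑ i ∈ s, 2 ^ i + (∑ i ∈ t, 2 ^ i) * p := by
  have hinj : Set.InjOn (fun i : ℕ => 2 ^ (i + 1)) s := fun a _ b _ h => by
    simpa using Nat.pow_right_injective le_rfl h
  have hinj' : Set.InjOn (fun i : ℕ => 2 ^ i * p) t := fun a _ b _ h =>
    Nat.pow_right_injective le_rfl (Nat.eq_of_mul_eq_mul_right hp.pos h)
  rw [Finset.sum_union, Finset.sum_image hinj, Finset.sum_image hinj', Finset.mul_sum,
    Finset.sum_mul]
  · simp only [pow_succ']
  · rw [Finset.disjoint_left]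
    intro d hd hd'
    obtain ⟨i, -, rfl⟩ := Finset.mem_image.mp hd
    obtain ⟨j, -, hj⟩ := Finset.mem_image.mp hd'
    have hdvd : p ∣ 2 ^ (i + 1) := Dvd.intro_left _ hj
    exact hp2 ((Nat.prime_dvd_prime_iff_eq hp Nat.prime_two).mp (hp.dvd_of_dvd_pow hdvd))

theorem isSPerfect_two_pow_mul_prime {p : ℕ} (hp : p.Prime) (hp2 : p ≠ 2) (m : ℤ)
    {k e j : ℕ} (he : e < 2 ^ k) (hj : j < 2 ^ k)
    (h : (2 : ℤ) ^ k * p = 1 - (2 ^ k - 1) * (2 + p) + (m + 1) * (2 * e + j * p)) :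
    IsSPerfect {-1, m} ((2 : ℤ) ^ k * p) := by
  obtain ⟨s, hs, rfl⟩ := exists_subset_range_sum_two_pow k e he
  obtain ⟨t, ht, rfl⟩ := exists_subset_range_sum_two_pow k j hj
  set D : Finset ℕ := s.image (fun i => 2 ^ (i + 1)) ∪ t.image (fun i => 2 ^ i * p) with hD
  refine ⟨?_, fun d => if d ∈ D then m else -1, fun d _ => ?_, ?_⟩
  · have hpos : 0 < 2 ^ k := by positivity
    have habs : ((2 : ℤ) ^ k * p).natAbs = 2 ^ k * p := by
      simp [Int.natAbs_mul, Int.natAbs_pow]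
    rw [habs]
    nlinarith [hp.two_le]
  · dsimp only
    split_ifs <;> simp
  · have hsub : D ⊆ midDivisors ((2 : ℤ) ^ k * p) := by
      rw [midDivisors_two_pow_mul_prime hp hp2]
      exact Finset.union_subset_union (Finset.image_subset_image hs)
        (Finset.image_subset_image ht)
    have hmid : ∑ d ∈ midDivisors ((2 : ℤ) ^ k * p), (d : ℤ) = (2 ^ k - 1) * (2 + p) := by
      have hgeom : ∑ i ∈ Finset.range k, (2 : ℤ) ^ i = 2 ^ k - 1 := by
        simpa using geom_sum_mul (2 : ℤ) k
      rw [midDivisors_two_pow_mul_prime hp hp2, ← Nat.cast_sum,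
        sum_image_two_pow_union hp hp2]
      push_cast
      rw [hgeom]
      ring
    have hsumD : ∑ d ∈ D, (d : ℤ) =
        2 * ((∑ i ∈ s, 2 ^ i : ℕ) : ℤ) + ((∑ i ∈ t, 2 ^ i : ℕ) : ℤ) * p := by
      rw [← Nat.cast_sum, hD, sum_image_two_pow_union hp hp2]
      push_cast
      rfl
    have hsplit : ∀ d : ℕ, (if d ∈ D then m else -1) * (d : ℤ) =
        (m + 1) * (if d ∈ D then (d : ℤ) else 0) - d := fun d => by
      split_ifs <;> ring
    simp only [hsplit]
    rw [Finset.sum_sub_distrib, ← Finset.mul_sum, Finset.sum_ite_mem,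
      Finset.inter_eq_right.mpr hsub, hmid, hsumD, h]
    ring

theorem stmt11 (m : ℤ) (hm : 1 ≤ m) (β : ℕ)
    (hβ : (2 : ℤ) ^ β ∣ m + 1) (hβ' : ¬ (2 : ℤ) ^ (β + 1) ∣ m + 1)
    (α : ℕ) (hαβ : β < α) (hmod : (2 : ℤ) ^ α ≡ 1 [ZMOD (m + 1) / 2 ^ β])
    (p : ℕ) (hp : p.Prime)
    (hpmod : (p : ℤ) ≡ 2 * (2 ^ (α + 1) - 1) - 1 [ZMOD 2 * (m + 1)]) :
    ∃ k : ℕ, α ≤ k ∧ IsSPerfect {-1, m} ((2 : ℤ) ^ k * p) := by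
  obtain ⟨q, hq⟩ := hβ
  rw [hq, Int.mul_ediv_cancel_left _ (by positivity)] at hmod
  obtain ⟨c, hc⟩ := hpmod.symm.dvd
  have hp2 : p ≠ 2 := by
    rintro rfl
    rw [pow_succ, mul_assoc] at hc
    push_cast at hc
    omega
  have hαk : α ≤ α * (p + 1) := Nat.le_mul_of_pos_right α (by omega)
  refine ⟨α * (p + 1), hαk, ?_⟩
  obtain ⟨l, hl⟩ : ∃ l, α * (p + 1) = l + 1 := ⟨α * (p + 1) - 1, by
    have := Nat.mul_pos (show 0 < α by omega) p.succ_pos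
    omega⟩
  have hpl : p < 2 ^ l := by
    have hle : p ≤ l := by nlinarith [show 1 ≤ α by omega]
    exact hle.trans_lt l.lt_two_pow_self
  have hqA : q ∣ (2 : ℤ) ^ α - 1 := hmod.symm.dvd
  have hqX : q ∣ (2 : ℤ) ^ (α * (p + 1)) - 1 := by
    rw [pow_mul]
    exact hqA.trans (sub_one_dvd_pow_sub_one _ _)
  have hdvd : m + 1 ∣ (2 : ℤ) ^ (α * (p + 1)) * (2 ^ α - 1) +
      2 ^ α * (2 ^ (α * (p + 1)) - 1) := by
    rw [hq]
    exact dvd_add (mul_dvd_mul (pow_dvd_pow 2 (hαβ.le.trans hαk)) hqA)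
      (mul_dvd_mul (pow_dvd_pow 2 hαβ.le) hqX)
  rw [hl] at hdvd ⊢
  obtain ⟨r, hr⟩ := hdvd
  have hT : ∃ T : ℤ, 2 * (m + 1) * T = (2 * 2 ^ (l + 1) - 1) * (p + 1) - 2 :=
    ⟨2 * r + (2 * 2 ^ (l + 1) - 1) * c, by
      rw [pow_succ 2 α] at hc
      linear_combination (-4) * hr - (2 * 2 ^ (l + 1) - 1) * hc⟩
  obtain ⟨T, hT⟩ := hT
  have hplz : (p : ℤ) < 2 ^ l := by exact_mod_cast hpl
  have hp0 : (2 : ℤ) ≤ p := by exact_mod_cast hp.two_le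
  rw [pow_succ] at hT
  have hT0 : 0 ≤ T := by
    by_contra! hneg
    nlinarith
  lift T to ℕ using hT0
  have hTle : 4 * (T : ℤ) ≤ 4 * 2 ^ l * (p + 1) - p - 3 := by
    nlinarith [mul_nonneg (show 0 ≤ m - 1 by linarith) (Nat.cast_nonneg (α := ℤ) T)]
  have key : ∃ e j : ℕ, e < 2 * 2 ^ l ∧ j < 2 ^ l ∧ T = e + j * p := by
    by_cases hlt : T / p < 2 ^ l
    · exact ⟨T % p, T / p, by have := Nat.mod_lt T hp.pos; omega, hlt,
        by rw [mul_comm]; exact (Nat.mod_add_div T p).symm⟩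
    · have hge : 2 ^ l * p ≤ T := (Nat.le_div_iff_mul_le hp.pos).mp (not_lt.mp hlt)
      have hle : (2 ^ l - 1) * p ≤ T := (Nat.mul_le_mul_right p (Nat.sub_le _ _)).trans hge
      refine ⟨T - (2 ^ l - 1) * p, 2 ^ l - 1, ?_, by omega, by omega⟩
      zify [hle, Nat.one_le_two_pow (n := l)]
      nlinarith
  obtain ⟨e, j, he, hj, rfl⟩ := key
  refine isSPerfect_two_pow_mul_prime hp hp2 m (e := e) (j := 2 * j)
    (by rw [pow_succ]; omega) (by rw [pow_succ]; omega) ?_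
  rw [pow_succ]
  push_cast at hT ⊢
  linear_combination -hT
end

section
/- An integer n can be written as n = 1 + Σ_{j=1}^{k} λ_j·2^j for some integer k ≥ 1 and coefficients λ_1, …, λ_k ∈ {−1, 1} if and only if n ≡ 3 (mod 4). -/
/-- A signed sum of `2, 4, …, 2 ^ k` with `k ≥ 1` is congruent to `2` modulo `4`. -/
theorem signed_sum_two_pow_modEq {k : ℕ} (hk : 1 ≤ k) {lam : ℕ → ℤ}
    (hlam : ∀ j ∈ Finset.Icc 1 k, lam j ∈ ({-1, 1} : Set ℤ)) :
    ∑ j ∈ Finset.Icc 1 k, lam j * 2 ^ j ≡ 2 [ZMOD 4] := by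
  induction k, hk using Nat.le_induction with
  | base =>
    rcases hlam 1 (by simp) with h | h <;> simp_all [Int.ModEq]
  | succ k hk ih =>
    have hsum := ih fun j hj ↦ hlam j (Finset.Icc_subset_Icc_right k.le_succ hj)
    have hlast : lam (k + 1) * 2 ^ (k + 1) ≡ 0 [ZMOD 4] :=
      Int.modEq_zero_iff_dvd.2 <| dvd_mul_of_dvd_right
        (show (4 : ℤ) ∣ 2 ^ (k + 1) from pow_dvd_pow 2 (show 2 ≤ k + 1 by omega)) _
    rw [Finset.sum_Icc_succ_top (by omega)]
    exact hsum.add hlast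

/-- Every integer congruent to `2` modulo `4` and of absolute value less than `2 ^ (k + 1)` is a
signed sum of `2, 4, …, 2 ^ k`. -/
theorem exists_signed_sum_two_pow {k : ℕ} (hk : 1 ≤ k) {s : ℤ} (hs : s ≡ 2 [ZMOD 4])
    (hlt : |s| < 2 ^ (k + 1)) :
    ∃ lam : ℕ → ℤ, (∀ j ∈ Finset.Icc 1 k, lam j ∈ ({-1, 1} : Set ℤ)) ∧
      ∑ j ∈ Finset.Icc 1 k, lam j * 2 ^ j = s := by
  induction k, hk using Nat.le_induction generalizing s with
  | base =>
    rw [abs_lt] at hlt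
    have h : s = -2 ∨ s = 2 := by
      unfold Int.ModEq at hs
      omega
    rcases h with rfl | rfl
    · exact ⟨fun _ ↦ -1, by simp, by simp⟩
    · exact ⟨fun _ ↦ 1, by simp, by simp⟩
  | succ k hk ih =>
    obtain ⟨ε, hε, hlt'⟩ : ∃ ε ∈ ({-1, 1} : Set ℤ), |s - ε * 2 ^ (k + 1)| < 2 ^ (k + 1) := by
      rw [abs_lt, pow_succ] at hlt
      have hs0 : s ≠ 0 := by
        rintro rfl
        exact absurd hs (by decide)
      rcases hs0.lt_or_gt with h | h
      · exact ⟨-1, by simp, abs_lt.2 ⟨by linarith, by linarith⟩⟩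
      · exact ⟨1, by simp, abs_lt.2 ⟨by linarith, by linarith⟩⟩
    have hmod : s - ε * 2 ^ (k + 1) ≡ 2 [ZMOD 4] := by
      have h : ε * 2 ^ (k + 1) ≡ 0 [ZMOD 4] :=
        Int.modEq_zero_iff_dvd.2 <| dvd_mul_of_dvd_right
          (show (4 : ℤ) ∣ 2 ^ (k + 1) from pow_dvd_pow 2 (show 2 ≤ k + 1 by omega)) _
      simpa using hs.sub h
    obtain ⟨lam, hlam, hsum⟩ := ih hmod hlt'
    have hne : ∀ j ∈ Finset.Icc 1 k, j ≠ k + 1 := by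
      intro j hj
      rw [Finset.mem_Icc] at hj
      omega
    refine ⟨Function.update lam (k + 1) ε, fun j hj ↦ ?_, ?_⟩
    · rcases eq_or_ne j (k + 1) with rfl | hj'
      · simpa using hε
      · rw [Function.update_of_ne hj']
        rw [Finset.mem_Icc] at hj
        exact hlam j (Finset.mem_Icc.2 ⟨hj.1, by omega⟩)
    · rw [Finset.sum_Icc_succ_top (by omega), Function.update_self,
        Finset.sum_congr rfl fun j hj ↦ by rw [Function.update_of_ne (hne j hj)], hsum]
      ring

theorem stmt13 (n : ℤ) :
    (∃ k : ℕ, 1 ≤ k ∧ ∃ lam : ℕ → ℤ,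
        (∀ j ∈ Finset.Icc 1 k, lam j ∈ ({-1, 1} : Set ℤ)) ∧
        n = 1 + ∑ j ∈ Finset.Icc 1 k, lam j * 2 ^ j) ↔ n ≡ 3 [ZMOD 4] := by
  constructor
  · rintro ⟨k, hk, lam, hlam, rfl⟩
    exact (signed_sum_two_pow_modEq hk hlam).add_left 1
  · intro hn
    have hlt : |n - 1| < 2 ^ ((n - 1).natAbs + 1 + 1) := by
      rw [Int.abs_eq_natAbs]
      exact_mod_cast Nat.lt_two_pow_self.trans
        (Nat.pow_lt_pow_right one_lt_two (by omega))
    obtain ⟨lam, hlam, hsum⟩ := exists_signed_sum_two_pow (by omega) (hn.sub_right 1) hlt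
    exact ⟨_, by omega, lam, hlam, by rw [hsum]; ring⟩
end

section
/- Let n be an integer with |n| > 1 and let p be a prime not dividing n. If n is {−1, 1}-perfect, then n·p^k is {−1, 1}-perfect for every integer k ≥ 1. -/
theorem sum_divisors_eq_midDivisors (n : ℤ) (hn : 1 < n.natAbs) (f : ℕ → ℤ) :
    ∑ d ∈ n.natAbs.divisors, f d = f 1 + f n.natAbs + ∑ d ∈ midDivisors n, f d := by
  have h : n.natAbs.divisors = insert 1 (insert n.natAbs (midDivisors n)) := by
    ext d
    simp only [midDivisors, Finset.mem_insert, Finset.mem_filter, Nat.mem_divisors]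
    constructor
    · rintro ⟨hd, h0⟩
      have := Nat.le_of_dvd (by omega) hd
      have := Nat.pos_of_dvd_of_pos hd (by omega)
      by_cases h1 : d = 1
      · exact .inl h1
      by_cases h2 : d = n.natAbs
      · exact .inr (.inl h2)
      · exact .inr (.inr ⟨⟨hd, h0⟩, by omega, by omega⟩)
    · rintro (rfl | rfl | h)
      · exact ⟨one_dvd _, by omega⟩
      · exact ⟨dvd_rfl, by omega⟩
      · exact h.1
  rw [h, Finset.sum_insert, Finset.sum_insert, add_assoc]
  · simp [midDivisors]
  · simp [midDivisors, hn.ne]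

/-- Moving `n = sign n * |n|` to the right-hand side turns perfection into a vanishing signed sum
over all divisors. -/
theorem isSPerfect_iff_sum_divisors (n : ℤ) (hn : 1 < n.natAbs) :
    IsSPerfect {-1, 1} n ↔ ∃ mu : ℕ → ℤ, mu 1 = 1 ∧ mu n.natAbs = -n.sign ∧
      (∀ d ∈ n.natAbs.divisors, mu d ∈ ({-1, 1} : Set ℤ)) ∧
      ∑ d ∈ n.natAbs.divisors, mu d * (d : ℤ) = 0 := by
  have hsign : n.sign * (n.natAbs : ℤ) = n := Int.sign_mul_natAbs n
  constructor
  · rintro ⟨-, lam, hlam, hsum⟩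
    have hmid : ∀ d ∈ midDivisors n, d ≠ 1 ∧ d ≠ n.natAbs := fun d hd => by
      have := (Finset.mem_filter.mp hd).2
      omega
    refine ⟨fun d => if d = 1 then 1 else if d = n.natAbs then -n.sign else lam d,
      by simp, by simp [hn.ne'], fun d hd => ?_, ?_⟩
    · dsimp only
      split_ifs with h1 h2
      · simp
      · rcases lt_or_gt_of_ne (show n ≠ 0 by rintro rfl; simp at hn) with h | h
        · simp [Int.sign_eq_neg_one_of_neg h]
        · simp [Int.sign_eq_one_of_pos h]
      · have := Nat.divisor_le hd
        have := Nat.pos_of_mem_divisors hd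
        exact hlam d (Finset.mem_filter.mpr ⟨hd, by omega, by omega⟩)
    · have hcongr : ∑ d ∈ midDivisors n,
          (if d = 1 then 1 else if d = n.natAbs then -n.sign else lam d) * (d : ℤ) =
          ∑ d ∈ midDivisors n, lam d * (d : ℤ) :=
        Finset.sum_congr rfl fun d hd => by simp only [(hmid d hd).1, (hmid d hd).2, if_false]
      rw [sum_divisors_eq_midDivisors n hn, hcongr]
      simp only [if_true, hn.ne', if_false, neg_mul, hsign]
      push_cast
      linarith
  · rintro ⟨mu, h1, hN, hmu, hsum⟩
    refine ⟨hn, mu, fun d hd => hmu d (Finset.mem_filter.mp hd).1, ?_⟩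
    rw [sum_divisors_eq_midDivisors n hn, h1, hN, neg_mul, hsign] at hsum
    push_cast at hsum
    linarith

theorem stmt14 (n : ℤ) (hn : 1 < n.natAbs) (p : ℕ) (hp : p.Prime)
    (hpn : ¬ (p : ℤ) ∣ n) (h : IsSPerfect {-1, 1} n) (k : ℕ) (hk : 1 ≤ k) :
    IsSPerfect {-1, 1} (n * (p : ℤ) ^ k) := by
  obtain ⟨mu, h1, hN, hmu, hsum⟩ := (isSPerfect_iff_sum_divisors n hn).mp h
  have habs : (n * (p : ℤ) ^ k).natAbs = n.natAbs * p ^ k := by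
    simp [Int.natAbs_mul, Int.natAbs_pow]
  have hcop : n.natAbs.Coprime (p ^ k) :=
    (((Nat.Prime.coprime_iff_not_dvd hp).mpr (by rwa [← Int.natCast_dvd])).symm).pow_right k
  have hpk : 0 < p ^ k := pow_pos hp.pos k
  have hbig : 1 < (n * (p : ℤ) ^ k).natAbs := by
    rw [habs]; exact hn.trans_le (Nat.le_mul_of_pos_right _ hpk)
  have hn0 : n.natAbs ≠ 0 := by omega
  refine (isSPerfect_iff_sum_divisors _ hbig).mpr ⟨fun e => mu (e.gcd n.natAbs), ?_, ?_, ?_, ?_⟩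
  · simpa using h1
  · have hs : ((p : ℤ) ^ k).sign = 1 := Int.sign_eq_one_of_pos (by exact_mod_cast hpk)
    simp [habs, hN, Int.sign_mul, hs]
  · exact fun d _ => hmu _ (Nat.mem_divisors.mpr ⟨Nat.gcd_dvd_right _ _, hn0⟩)
  · rw [habs, Nat.divisors_mul, Finset.mul_def,
      Finset.sum_image (by exact_mod_cast hcop.mul_injOn_divisors),
      Finset.sum_product_right]
    refine Finset.sum_eq_zero fun q hq => ?_
    have hq' : q.Coprime n.natAbs := (hcop.coprime_dvd_right (Nat.dvd_of_mem_divisors hq)).symm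
    calc ∑ d ∈ n.natAbs.divisors, mu ((d * q).gcd n.natAbs) * ((d * q : ℕ) : ℤ)
        = ∑ d ∈ n.natAbs.divisors, mu d * (d : ℤ) * q := Finset.sum_congr rfl fun d hd => by
          rw [hq'.gcd_mul_right_cancel, Nat.gcd_eq_left (Nat.dvd_of_mem_divisors hd)]
          push_cast
          ring
      _ = 0 := by rw [← Finset.sum_mul, hsum, zero_mul]
end

section
/- Let n be an integer and let p be a prime not dividing n. If n·p is {−1, 1}-perfect, then n·p^{2k−1} is {−1, 1}-perfect for every integer k ≥ 1. -/
/-- `m` is `{-1, 1}`-perfect iff some signed sum of all positive divisors of `m`, with sign `1` at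
`1` and the sign opposite to that of `m` at `|m|`, vanishes. -/
theorem isSPerfect_iff_sum_divisors_s15 (m : ℤ) :
    IsSPerfect {-1, 1} m ↔ 1 < m.natAbs ∧ ∃ μ : ℕ → ℤ,
      (∀ d ∈ m.natAbs.divisors, μ d = -1 ∨ μ d = 1) ∧ μ 1 = 1 ∧
      μ m.natAbs = -m.sign ∧ ∑ d ∈ m.natAbs.divisors, μ d * (d : ℤ) = 0 := by
  refine and_congr_right fun hm => ?_
  have hdiv : m.natAbs.divisors = insert 1 (insert m.natAbs (midDivisors m)) := by
    ext d
    simp only [midDivisors, Finset.mem_insert, Finset.mem_filter, Nat.mem_divisors]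
    constructor
    · rintro ⟨hd, h0⟩
      have := Nat.le_of_dvd (by lia) hd
      have := Nat.pos_of_dvd_of_pos hd (by lia)
      lia
    · rintro (rfl | rfl | h)
      · exact ⟨one_dvd _, by lia⟩
      · exact ⟨dvd_rfl, by lia⟩
      · exact h.1
  have hmid {d : ℕ} (hd : d ∈ midDivisors m) : 1 < d ∧ d < m.natAbs :=
    (Finset.mem_filter.1 hd).2
  have hsum (μ : ℕ → ℤ) : ∑ d ∈ m.natAbs.divisors, μ d * (d : ℤ) =
      μ 1 + (μ m.natAbs * (m.natAbs : ℤ) + ∑ d ∈ midDivisors m, μ d * (d : ℤ)) := by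
    rw [hdiv, Finset.sum_insert, Finset.sum_insert, Nat.cast_one, mul_one]
    · exact fun h => (hmid h).2.ne rfl
    · rw [Finset.mem_insert]
      rintro (h | h)
      · lia
      · exact (hmid h).1.ne rfl
  have hsign : m.sign * (m.natAbs : ℤ) = m := Int.sign_mul_natAbs m
  constructor
  · rintro ⟨lam, hlam, heq⟩
    have hval (d : ℕ) (hd : d ∈ midDivisors m) :
        (if d = 1 then 1 else if d = m.natAbs then -m.sign else lam d) = lam d := by
      rw [if_neg (hmid hd).1.ne', if_neg (hmid hd).2.ne]
    refine ⟨fun d => if d = 1 then 1 else if d = m.natAbs then -m.sign else lam d,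
      fun d hd => ?_, if_pos rfl, ?_, ?_⟩
    · rw [hdiv, Finset.mem_insert, Finset.mem_insert] at hd
      dsimp only
      split_ifs with h1 h2
      · exact Or.inr rfl
      · rcases lt_trichotomy m 0 with h | h | h
        · simp [Int.sign_eq_neg_one_of_neg h]
        · simp [h] at hm
        · simp [Int.sign_eq_one_of_pos h]
      · exact hlam d (by tauto)
    · dsimp only
      rw [if_neg hm.ne', if_pos rfl]
    · rw [hsum, Finset.sum_congr rfl fun d hd => by rw [hval d hd], if_pos rfl,
        if_neg hm.ne', if_pos rfl]
      linarith
  · rintro ⟨μ, hμ, h1, hlast, h0⟩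
    refine ⟨μ, fun d hd => hμ d (Finset.mem_filter.1 hd).1, ?_⟩
    rw [hsum, h1, hlast] at h0
    linarith

theorem dvd_mul_prime_of_dvd_mul_pow {N p e d : ℕ} (hp : p.Prime)
    (h : d ∣ N * p ^ e) (hd : ¬ p ^ 2 ∣ d) : d ∣ N * p := by
  have coprime_case {b : ℕ} (hb : b ∣ N * p ^ e) (hpb : ¬ p ∣ b) : b ∣ N :=
    (((hp.coprime_iff_not_dvd.2 hpb).symm).pow_right e).dvd_of_dvd_mul_right hb
  by_cases hpd : p ∣ d
  · obtain ⟨b, rfl⟩ := hpd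
    have hpb : ¬ p ∣ b := fun hb => hd (by rw [sq]; exact mul_dvd_mul_left p hb)
    rw [mul_comm]
    exact mul_dvd_mul_right (coprime_case (dvd_of_mul_left_dvd h) hpb) p
  · exact (coprime_case h hpd).mul_right p

theorem sum_divisors_mul_prime_pow_add_two {N p : ℕ} (hp : p.Prime) (hN : N ≠ 0)
    (hpN : ¬ p ∣ N) (e : ℕ) (f : ℕ → ℤ) :
    ∑ d ∈ (N * p ^ (e + 2)).divisors, f d =
      ∑ d ∈ (N * p ^ e).divisors, f (p ^ 2 * d) + ∑ d ∈ (N * p).divisors, f d := by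
  have hp0 := hp.ne_zero
  have hpow : N * p ^ (e + 2) = p ^ 2 * (N * p ^ e) := by ring
  have hmul : (N * p ^ (e + 2)).divisors.filter (p ^ 2 ∣ ·) =
      (N * p ^ e).divisors.image (p ^ 2 * ·) := by
    ext d
    simp only [Finset.mem_filter, Finset.mem_image, Nat.mem_divisors]
    constructor
    · rintro ⟨⟨hd, -⟩, c, rfl⟩
      rw [hpow] at hd
      exact ⟨c, ⟨Nat.dvd_of_mul_dvd_mul_left (by positivity) hd, by positivity⟩, rfl⟩
    · rintro ⟨c, ⟨hc, -⟩, rfl⟩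
      exact ⟨⟨hpow ▸ mul_dvd_mul_left _ hc, by positivity⟩, dvd_mul_right _ _⟩
  have hnot : (N * p ^ (e + 2)).divisors.filter (¬ p ^ 2 ∣ ·) = (N * p).divisors := by
    ext d
    simp only [Finset.mem_filter, Nat.mem_divisors]
    constructor
    · rintro ⟨⟨hd, -⟩, hpd⟩
      exact ⟨dvd_mul_prime_of_dvd_mul_pow hp hd hpd, by positivity⟩
    · rintro ⟨hd, -⟩
      refine ⟨⟨hd.trans (mul_dvd_mul_left N (dvd_pow_self p (by lia))), by positivity⟩,
        fun h => hpN ?_⟩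
      have := h.trans hd
      rw [sq] at this
      exact Nat.dvd_of_mul_dvd_mul_right hp.pos this
  rw [← Finset.sum_filter_add_sum_filter_not _ (p ^ 2 ∣ ·), hmul, hnot, Finset.sum_image]
  exact fun a _ b _ hab => Nat.eq_of_mul_eq_mul_left (by positivity) hab

theorem IsSPerfect.mul_prime_pow_add_two {n : ℤ} {p e : ℕ} (hp : p.Prime)
    (hpn : ¬ (p : ℤ) ∣ n) (h : IsSPerfect {-1, 1} (n * p))
    (h' : IsSPerfect {-1, 1} (n * (p : ℤ) ^ e)) :
    IsSPerfect {-1, 1} (n * (p : ℤ) ^ (e + 2)) := by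
  rw [isSPerfect_iff_sum_divisors_s15] at h h' ⊢
  have hp0 := hp.pos
  have hpN : ¬ p ∣ n.natAbs := by rwa [← Int.natCast_dvd]
  have hN : n.natAbs ≠ 0 := fun h0 => hpN (h0 ▸ dvd_zero p)
  have hsign (i : ℕ) : (n * (p : ℤ) ^ i).sign = n.sign := by
    rw [Int.sign_mul, Int.sign_eq_one_of_pos (pow_pos (by exact_mod_cast hp0) i), mul_one]
  simp only [Int.natAbs_mul, Int.natAbs_pow, Int.natAbs_natCast, hsign] at h h' ⊢
  obtain ⟨-, μ, hμ, hμ1, -, hμ0⟩ := h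
  obtain ⟨hlt, ν, hν, -, hνlast, hν0⟩ := h'
  have hsq : 0 < p ^ 2 := by positivity
  have hpow : n.natAbs * p ^ (e + 2) = p ^ 2 * (n.natAbs * p ^ e) := by ring
  have hnot {d : ℕ} (hd : d ∈ (n.natAbs * p).divisors) : ¬ p ^ 2 ∣ d := fun h => by
    have := h.trans (Nat.dvd_of_mem_divisors hd)
    rw [sq] at this
    exact hpN (Nat.dvd_of_mul_dvd_mul_right hp0 this)
  refine ⟨hpow ▸ hlt.trans_le (Nat.le_mul_of_pos_left _ hsq),
    fun d => if p ^ 2 ∣ d then ν (d / p ^ 2) else μ d, fun d hd => ?_, ?_, ?_, ?_⟩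
  · have hd := Nat.dvd_of_mem_divisors hd
    dsimp only
    split_ifs with hpd
    · obtain ⟨c, rfl⟩ := hpd
      rw [Nat.mul_div_cancel_left c hsq]
      rw [hpow] at hd
      exact hν c (Nat.mem_divisors.2 ⟨Nat.dvd_of_mul_dvd_mul_left hsq hd, by positivity⟩)
    · exact hμ d (Nat.mem_divisors.2 ⟨dvd_mul_prime_of_dvd_mul_pow hp hd hpd, by positivity⟩)
  · dsimp only
    rw [if_neg, hμ1]
    exact hnot (Nat.one_mem_divisors.2 (by positivity))
  · dsimp only
    rw [hpow, if_pos (dvd_mul_right _ _), Nat.mul_div_cancel_left _ hsq, hνlast]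
  · have hmul : ∑ d ∈ (n.natAbs * p ^ e).divisors,
        (if p ^ 2 ∣ p ^ 2 * d then ν (p ^ 2 * d / p ^ 2) else μ (p ^ 2 * d)) *
          ((p ^ 2 * d : ℕ) : ℤ) = ((p ^ 2 : ℕ) : ℤ) * ∑ d ∈ (n.natAbs * p ^ e).divisors,
            ν d * (d : ℤ) := by
      rw [Finset.mul_sum]
      refine Finset.sum_congr rfl fun d _ => ?_
      rw [if_pos (dvd_mul_right _ _), Nat.mul_div_cancel_left d hsq, Nat.cast_mul, mul_left_comm]
    have hrest : ∑ d ∈ (n.natAbs * p).divisors,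
        (if p ^ 2 ∣ d then ν (d / p ^ 2) else μ d) * (d : ℤ) =
          ∑ d ∈ (n.natAbs * p).divisors, μ d * (d : ℤ) :=
      Finset.sum_congr rfl fun d hd => by rw [if_neg (hnot hd)]
    rw [sum_divisors_mul_prime_pow_add_two hp hN hpN e, hmul, hrest, hν0, hμ0, mul_zero,
      add_zero]

theorem stmt15 (n : ℤ) (p : ℕ) (hp : p.Prime) (hpn : ¬ (p : ℤ) ∣ n)
    (h : IsSPerfect {-1, 1} (n * p)) (k : ℕ) (hk : 1 ≤ k) :
    IsSPerfect {-1, 1} (n * (p : ℤ) ^ (2 * k - 1)) := by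
  induction k, hk using Nat.le_induction with
  | base => simpa using h
  | succ k hk ih =>
    rw [show 2 * (k + 1) - 1 = 2 * k - 1 + 2 by lia]
    exact h.mul_prime_pow_add_two hp hpn ih
end

section
/- If n is a {−1, 1}-perfect number, then 2n is also a {−1, 1}-perfect number. -/
/-- The proper divisors `d` of `n` for which `2 * d` is not a divisor of `n`. -/
def newDivisorHalves (n : ℤ) : Finset ℕ :=
  n.natAbs.properDivisors.filter (fun d => ¬ 2 * d ∣ n.natAbs)

theorem mem_newDivisorHalves {n : ℤ} {d : ℕ} :
    d ∈ newDivisorHalves n ↔ (d ∣ n.natAbs ∧ d < n.natAbs) ∧ ¬ 2 * d ∣ n.natAbs := by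
  simp only [newDivisorHalves, Finset.mem_filter, Nat.mem_properDivisors]

theorem midDivisors_two_mul {n : ℤ} (hn : 1 < n.natAbs) :
    midDivisors (2 * n) =
      insert n.natAbs (midDivisors n) ∪ (newDivisorHalves n).image (2 * ·) := by
  ext d
  simp only [Finset.mem_union, Finset.mem_insert, Finset.mem_image, mem_midDivisors,
    mem_newDivisorHalves, Int.natAbs_mul, show Int.natAbs 2 = 2 from rfl]
  constructor
  · rintro ⟨hd, h1, h2⟩
    by_cases hdn : d ∣ n.natAbs
    · rcases (Nat.le_of_dvd (by omega) hdn).eq_or_lt with h | h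
      · exact Or.inl (Or.inl h)
      · exact Or.inl (Or.inr ⟨hdn, h1, h⟩)
    · have h2d : 2 ∣ d := by
        by_contra hodd
        exact hdn ((Nat.prime_two.coprime_iff_not_dvd.mpr hodd).symm.dvd_of_dvd_mul_left hd)
      obtain ⟨c, rfl⟩ := h2d
      exact Or.inr ⟨c, ⟨⟨Nat.dvd_of_mul_dvd_mul_left two_pos hd, by omega⟩, hdn⟩, rfl⟩
  · rintro ((rfl | ⟨hd, h1, h2⟩) | ⟨c, ⟨⟨hc, hlt⟩, -⟩, rfl⟩)
    · exact ⟨dvd_mul_left _ _, hn, by omega⟩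
    · exact ⟨hd.mul_left 2, h1, by omega⟩
    · have := Nat.pos_of_dvd_of_pos hc (by omega)
      exact ⟨mul_dvd_mul_left 2 hc, by omega, by omega⟩

/-- Coefficients for `2 * n` may be chosen independently on the middle divisors of `n`,
on `|n|`, and on the divisors of `2 * n` that do not divide `n`. -/
theorem isSPerfect_two_mul_of_sum {S : Set ℤ} {n : ℤ} (hn : 1 < n.natAbs) {f g : ℕ → ℤ} {s : ℤ}
    (hf : ∀ d ∈ midDivisors n, f d ∈ S) (hs : s ∈ S) (hg : ∀ d ∈ newDivisorHalves n, g d ∈ S)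
    (hsum : 2 * n = 1 + (s * n.natAbs + ∑ d ∈ midDivisors n, f d * (d : ℤ)
      + ∑ d ∈ newDivisorHalves n, g d * (2 * d : ℤ))) :
    IsSPerfect S (2 * n) := by
  set lam : ℕ → ℤ := fun x => if x = n.natAbs then s else if x ∣ n.natAbs then f x else g (x / 2)
    with hlam
  have lam_top : lam n.natAbs = s := by simp [hlam]
  have lam_mid : ∀ d ∈ midDivisors n, lam d = f d := fun d hd => by
    rw [mem_midDivisors] at hd
    simp [hlam, hd.1, hd.2.2.ne]
  have lam_new : ∀ d ∈ newDivisorHalves n, lam (2 * d) = g d := fun d hd => by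
    rw [mem_newDivisorHalves] at hd
    have hne : 2 * d ≠ n.natAbs := fun h => hd.2 (h ▸ dvd_rfl)
    simp [hlam, hd.2, hne]
  refine ⟨by rw [Int.natAbs_mul]; simp; omega, lam, ?_, ?_⟩
  · intro d hd
    rw [midDivisors_two_mul hn] at hd
    simp only [Finset.mem_union, Finset.mem_insert, Finset.mem_image] at hd
    rcases hd with (rfl | hd) | ⟨c, hc, rfl⟩
    · rwa [lam_top]
    · rw [lam_mid d hd]; exact hf d hd
    · rw [lam_new c hc]; exact hg c hc
  · have hdisj : Disjoint (insert n.natAbs (midDivisors n))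
        ((newDivisorHalves n).image (2 * ·)) := by
      rw [Finset.disjoint_left]
      intro d hd hd'
      obtain ⟨c, hc, rfl⟩ := Finset.mem_image.mp hd'
      rcases Finset.mem_insert.mp hd with h | h
      · exact (mem_newDivisorHalves.mp hc).2 (h ▸ dvd_rfl)
      · exact (mem_newDivisorHalves.mp hc).2 (mem_midDivisors.mp h).1
    have htop : n.natAbs ∉ midDivisors n := fun h => (mem_midDivisors.mp h).2.2.ne rfl
    rw [midDivisors_two_mul hn, Finset.sum_union hdisj, Finset.sum_insert htop,
      Finset.sum_image (fun a _ b _ h => Nat.eq_of_mul_eq_mul_left two_pos h), lam_top,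
      Finset.sum_congr rfl (fun d hd => by rw [lam_mid d hd]),
      Finset.sum_congr (s₁ := newDivisorHalves n) rfl
        (fun d hd => by rw [lam_new d hd, Nat.cast_mul, Nat.cast_two])]
    exact hsum

theorem newDivisorHalves_of_even {n : ℤ} (h2 : 2 ∣ n.natAbs) :
    newDivisorHalves n = (midDivisors n).filter (fun d => ¬ 2 * d ∣ n.natAbs) := by
  ext d
  simp only [mem_newDivisorHalves, Finset.mem_filter, mem_midDivisors]
  constructor
  · rintro ⟨⟨hd, hlt⟩, hnd⟩
    have hpos := Nat.pos_of_dvd_of_pos hd (by omega)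
    have hne : d ≠ 1 := by rintro rfl; exact hnd h2
    exact ⟨⟨hd, by omega, hlt⟩, hnd⟩
  · rintro ⟨⟨hd, -, hlt⟩, hnd⟩
    exact ⟨⟨hd, hlt⟩, hnd⟩

theorem newDivisorHalves_of_odd {n : ℤ} (hn : 1 < n.natAbs) (h2 : ¬ 2 ∣ n.natAbs) :
    newDivisorHalves n = insert 1 (midDivisors n) := by
  ext d
  simp only [mem_newDivisorHalves, Finset.mem_insert, mem_midDivisors]
  constructor
  · rintro ⟨⟨hd, hlt⟩, -⟩
    have hpos := Nat.pos_of_dvd_of_pos hd (by omega)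
    rcases (show 1 ≤ d from hpos).eq_or_lt with h | h
    · exact Or.inl h.symm
    · exact Or.inr ⟨hd, h, hlt⟩
  · rintro (rfl | ⟨hd, -, hlt⟩)
    · exact ⟨⟨one_dvd _, hn⟩, h2⟩
    · exact ⟨⟨hd, hlt⟩, fun h => h2 ((dvd_mul_right 2 d).trans h)⟩

theorem stmt16 (n : ℤ) (h : IsSPerfect {-1, 1} n) : IsSPerfect {-1, 1} (2 * n) := by
  obtain ⟨hn, lam, hlam, hsum⟩ := h
  have neg_mem : ∀ x ∈ ({-1, 1} : Set ℤ), -x ∈ ({-1, 1} : Set ℤ) := by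
    rintro x (rfl | rfl) <;> simp
  obtain ⟨s, hs, hsn⟩ : ∃ s ∈ ({-1, 1} : Set ℤ), s * n.natAbs = n := by
    rcases Int.natAbs_eq n with h | h
    · exact ⟨1, by simp, by omega⟩
    · exact ⟨-1, by simp, by omega⟩
  by_cases h2 : 2 ∣ n.natAbs
  · refine isSPerfect_two_mul_of_sum hn (s := s) (g := lam)
      (f := fun d => if ¬ 2 * d ∣ n.natAbs then -lam d else lam d) ?_ hs ?_ ?_
    · intro d hd
      split_ifs
      · exact hlam d hd
      · exact neg_mem _ (hlam d hd)
    · intro d hd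
      rw [newDivisorHalves_of_even h2] at hd
      exact hlam d (Finset.mem_filter.mp hd).1
    · rw [newDivisorHalves_of_even h2, Finset.sum_filter, add_assoc, ← Finset.sum_add_distrib,
        Finset.sum_congr rfl (g := fun d => lam d * (d : ℤ))
          (fun d _ => by split_ifs <;> ring), hsn]
      linarith
  · have h1 : 1 ∉ midDivisors n := fun h => (mem_midDivisors.mp h).2.1.ne rfl
    have lam_ne : ∀ d ∈ midDivisors n, Function.update lam 1 1 d = lam d := fun d hd =>
      Function.update_of_ne (ne_of_mem_of_not_mem hd h1) _ _
    refine isSPerfect_two_mul_of_sum hn (s := -s) (g := Function.update lam 1 1) (f := lam)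
      hlam (neg_mem _ hs) ?_ ?_
    · intro d hd
      rw [newDivisorHalves_of_odd hn h2, Finset.mem_insert] at hd
      rcases hd with rfl | hd
      · simp
      · rw [lam_ne d hd]; exact hlam d hd
    · rw [newDivisorHalves_of_odd hn h2, Finset.sum_insert h1, Function.update_self,
        Finset.sum_congr (s₁ := midDivisors n)
          (f := fun d => Function.update lam 1 1 d * (2 * d : ℤ))
          (g := fun d => 2 * (lam d * (d : ℤ))) rfl
          (fun d hd => by rw [lam_ne d hd]; ring), ← Finset.mul_sum, neg_mul, hsn]
      push_cast
      linarith
end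

section
/- If d ≥ 1 is an odd integer that is not a perfect square, then 2^k·d is {−1, 1}-perfect for all but finitely many integers k ≥ 1; that is, there exists K such that 2^k·d is {−1, 1}-perfect for every k ≥ K. -/
theorem insert_one_insert_self_midDivisors {n : ℕ} (hn : 1 < n) :
    insert 1 (insert n (midDivisors n)) = n.divisors := by
  ext x
  simp only [midDivisors, Int.natAbs_natCast, Finset.mem_insert, Finset.mem_filter,
    Nat.mem_divisors]
  constructor
  · rintro (rfl | rfl | h)
    · exact ⟨one_dvd _, by omega⟩
    · exact ⟨dvd_rfl, by omega⟩
    · exact h.1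
  · rintro ⟨h, h0⟩
    have := Nat.le_of_dvd (by omega) h
    have := Nat.pos_of_dvd_of_pos h (by omega)
    by_cases x = 1 <;> by_cases x = n <;> grind

theorem sum_midDivisors_add {n : ℕ} (hn : 1 < n) :
    ∑ x ∈ midDivisors n, x + n + 1 = ∑ x ∈ n.divisors, x := by
  rw [← insert_one_insert_self_midDivisors hn, Finset.sum_insert, Finset.sum_insert]
  · ring
  · simp [midDivisors]
  · simp [midDivisors, hn.ne]

/-- Choosing the coefficient `-1` exactly on `N` reduces perfectness to a subset sum problem. -/
theorem isSPerfect_of_subset_sum {n : ℕ} (hn : 1 < n) {N : Finset ℕ} (hN : N ⊆ midDivisors n)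
    (hsum : 2 * ∑ x ∈ N, x + 2 * n = ∑ x ∈ n.divisors, x) :
    IsSPerfect {-1, 1} (n : ℤ) := by
  refine ⟨by simpa using hn, fun x => if x ∈ N then -1 else 1, fun x _ => ?_, ?_⟩
  · by_cases hx : x ∈ N <;> simp [hx]
  · have hsplit : ∑ x ∈ midDivisors n, (if x ∈ N then (-1 : ℤ) else 1) * (x : ℤ)
        = ∑ x ∈ midDivisors n, (x : ℤ) - 2 * ∑ x ∈ N, (x : ℤ) := by
      rw [← Finset.sum_sdiff hN, ← Finset.sum_sdiff hN (f := fun x : ℕ => (x : ℤ)),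
        Finset.sum_congr rfl (g := fun x : ℕ => (x : ℤ)) (by
          intro x hx; simp [(Finset.mem_sdiff.1 hx).2]),
        Finset.sum_congr (s₁ := N) rfl (g := fun x : ℕ => -(x : ℤ)) (by
          intro x hx; simp [hx]), Finset.sum_neg_distrib]
      ring
    rw [hsplit]
    have h := sum_midDivisors_add hn
    rw [← hsum] at h
    zify at h
    linarith

theorem even_sum_divisors_of_not_isSquare {d : ℕ} (hodd : Odd d) (hsq : ¬ IsSquare d) :
    Even (∑ x ∈ d.divisors, x) := by
  have key : ∑ x ∈ d.divisors, (x : ZMod 2) = 0 := by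
    refine Finset.sum_involution (fun x _ => d / x) ?_ ?_ ?_ ?_
    · intro x hx
      have hx := Nat.dvd_of_mem_divisors hx
      rw [(ZMod.natCast_eq_one_iff_odd).2 (hodd.of_dvd_nat hx),
        (ZMod.natCast_eq_one_iff_odd).2 (hodd.of_dvd_nat (Nat.div_dvd_of_dvd hx))]
      decide
    · intro x hx _ h
      exact hsq ⟨x, by
        conv_lhs => rw [← Nat.div_mul_cancel (Nat.dvd_of_mem_divisors hx), h]⟩
    · intro x hx
      exact Nat.mem_divisors.2 ⟨Nat.div_dvd_of_dvd (Nat.dvd_of_mem_divisors hx), hodd.pos.ne'⟩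
    · intro x hx
      exact Nat.div_div_self (Nat.dvd_of_mem_divisors hx) hodd.pos.ne'
  exact (ZMod.natCast_eq_zero_iff_even).1 (by rw [Nat.cast_sum, key])

theorem sum_divisors_two_pow_mul {d : ℕ} (hodd : Odd d) (k : ℕ) :
    ∑ x ∈ (2 ^ k * d).divisors, x + ∑ x ∈ d.divisors, x = 2 ^ (k + 1) * ∑ x ∈ d.divisors, x := by
  have h2 : ∑ x ∈ (2 ^ k).divisors, x + 1 = 2 ^ (k + 1) := by
    rw [Nat.sum_divisors_prime_pow Nat.prime_two, Nat.geomSum_eq le_rfl]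
    have := Nat.one_le_two_pow (n := k + 1)
    omega
  rw [Nat.Coprime.sum_divisors_mul (hodd.coprime_two_left.pow_left k), ← h2]
  ring

/-- Every even number below `2 ^ k` is a sum of distinct powers `2 ^ j` with `0 < j < k`. -/
theorem exists_sum_two_pow_succ_eq {k r : ℕ} (hr : Even r) (hlt : r < 2 ^ k) :
    ∃ I : Finset ℕ, (∀ i ∈ I, i + 1 < k) ∧ ∑ i ∈ I, 2 ^ (i + 1) = r := by
  obtain ⟨q, rfl⟩ := hr
  refine ⟨q.bitIndices.toFinset, fun i hi => ?_, ?_⟩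
  · have h := Nat.two_pow_le_of_mem_bitIndices (List.mem_toFinset.1 hi)
    refine (Nat.pow_lt_pow_iff_right (one_lt_two)).1 (lt_of_le_of_lt ?_ hlt)
    rw [pow_succ]; omega
  · simp_rw [pow_succ]
    rw [← Finset.sum_mul]
    simp [mul_two]

theorem isSPerfect_two_pow_mul {d k : ℕ} (hodd : Odd d) (hsq : ¬ IsSquare d)
    (hk : d + ∑ x ∈ d.divisors, x < 2 ^ k) : IsSPerfect {-1, 1} ((2 ^ k * d : ℕ) : ℤ) := by
  have hd : 1 < d := by
    have := hodd.pos
    by_contra h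
    exact hsq ⟨1, by omega⟩
  obtain ⟨h, hh⟩ := even_sum_divisors_of_not_isSquare hodd hsq
  have hk1 : k ≠ 0 := by rintro rfl; simp at hk; omega
  have hkeven : Even (2 ^ k) := (even_two).pow_of_ne_zero hk1
  obtain ⟨D, hD, hDe⟩ : ∃ D : Finset ℕ, D ⊆ {d} ∧ Even (∑ x ∈ D, x + h) := by
    rcases Nat.even_or_odd h with he | ho
    · exact ⟨∅, by simp, by simpa using he⟩
    · exact ⟨{d}, subset_rfl, by simpa using hodd.add_odd ho⟩
  have hDle : ∑ x ∈ D, x ≤ d := by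
    simpa using Finset.sum_le_sum_of_subset (f := fun x => x) hD
  have hle : ∑ x ∈ D, x + h ≤ 2 ^ k := by omega
  have hhpos : 0 < h := by
    have := sum_midDivisors_add hd
    omega
  obtain ⟨I, hI, hIsum⟩ := exists_sum_two_pow_succ_eq (k := k) (r := 2 ^ k - (∑ x ∈ D, x + h))
    ((Nat.even_sub hle).2 (by simp [hkeven, hDe])) (by omega)
  have hmid : ∀ x ∈ midDivisors d, x ∣ d ∧ 1 < x ∧ x < d := by
    intro x hx
    simp only [midDivisors, Int.natAbs_natCast, Finset.mem_filter, Nat.mem_divisors] at hx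
    exact ⟨hx.1.1, hx.2⟩
  have hDmem : ∀ x ∈ D, x = d := fun x hx => Finset.mem_singleton.1 (hD hx)
  have hdisj1 : Disjoint ((midDivisors d).image (2 ^ k * ·)) (I.image fun i => 2 ^ (i + 1)) := by
    simp only [Finset.disjoint_left, Finset.mem_image]
    rintro _ ⟨x, hx, rfl⟩ ⟨i, hi, h⟩
    have := Nat.pow_lt_pow_right one_lt_two (hI i hi)
    have := (hmid x hx).2.1
    nlinarith
  have hdisj2 : Disjoint ((midDivisors d).image (2 ^ k * ·) ∪ I.image fun i => 2 ^ (i + 1)) D := by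
    simp only [Finset.disjoint_left, Finset.mem_union, Finset.mem_image]
    rintro y hy hyD
    rw [hDmem y hyD] at hy
    refine Nat.not_even_iff_odd.2 hodd ?_
    rcases hy with ⟨x, -, rfl⟩ | ⟨i, -, rfl⟩
    · exact hkeven.mul_right x
    · exact even_two.pow_of_ne_zero (by omega)
  have hpos : 1 < 2 ^ k := by omega
  refine isSPerfect_of_subset_sum (by nlinarith)
    (N := (midDivisors d).image (2 ^ k * ·) ∪ (I.image fun i => 2 ^ (i + 1)) ∪ D) ?_ ?_
  · intro y hy
    simp only [midDivisors, Int.natAbs_natCast, Finset.mem_filter, Nat.mem_divisors]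
    simp only [Finset.mem_union, Finset.mem_image] at hy
    rcases hy with (⟨x, hx, rfl⟩ | ⟨i, hi, rfl⟩) | hy
    · obtain ⟨hxd, hx1, hxlt⟩ := hmid x hx
      exact ⟨⟨Nat.mul_dvd_mul_left _ hxd, by positivity⟩, by nlinarith, by nlinarith⟩
    · have hlt := Nat.pow_lt_pow_right one_lt_two (hI i hi)
      exact ⟨⟨(pow_dvd_pow 2 (hI i hi).le).mul_right d, by positivity⟩,
        Nat.one_lt_two_pow (by omega), by nlinarith⟩
    · rw [hDmem y hy]
      exact ⟨⟨dvd_mul_left _ _, by positivity⟩, hd, by nlinarith⟩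
  · rw [Finset.sum_union hdisj2, Finset.sum_union hdisj1,
      Finset.sum_image (fun a _ b _ hab => Nat.eq_of_mul_eq_mul_left (by positivity) hab),
      Finset.sum_image (fun a _ b _ hab => by simpa using Nat.pow_right_injective le_rfl hab),
      ← Finset.mul_sum, hIsum]
    have h1 := sum_midDivisors_add hd
    have h2 := sum_divisors_two_pow_mul hodd k
    rw [hh] at h1 h2
    have h3 := Nat.sub_add_cancel hle
    rw [pow_succ] at h2
    generalize 2 ^ k - (∑ x ∈ D, x + h) = r at *
    have h4 := congrArg (2 ^ k * ·) h1
    linarith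

theorem stmt17 (d : ℕ) (hd : 1 ≤ d) (hodd : Odd d) (hsq : ¬ IsSquare d) :
    ∃ K : ℕ, 1 ≤ K ∧ ∀ k : ℕ, K ≤ k → IsSPerfect {-1, 1} ((2 : ℤ) ^ k * d) := by
  refine ⟨d + ∑ x ∈ d.divisors, x, by omega, fun k hk => ?_⟩
  exact_mod_cast isSPerfect_two_pow_mul hodd hsq (hk.trans_lt Nat.lt_two_pow_self)
end

section
/- If n > 1 is a {−1, 1}-perfect number, then σ(n) is even; consequently, if 2^k·d is {−1, 1}-perfect for some integers k ≥ 0 and d ≥ 1 with d odd, then d is not a perfect square. -/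
/-- The sum of the divisors of an odd square is odd: pair each divisor `e` of `m * m` other than `m`
with `m * m / e`. -/
theorem odd_sum_divisors_mul_self {m : ℕ} (hm : Odd m) : Odd (∑ e ∈ (m * m).divisors, e) := by
  have hm0 : m ≠ 0 := hm.pos.ne'
  have hodd : ∀ e, e ∣ m * m → Odd e := fun e he => (hm.mul hm).of_dvd_nat he
  have hpair : ∑ e ∈ (m * m).divisors.erase m, (e : ZMod 2) = 0 := by
    refine Finset.sum_involution (fun e _ => m * m / e) ?_ ?_ ?_ ?_
    · intro e he
      have hd := Nat.dvd_of_mem_divisors (Finset.mem_of_mem_erase he)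
      rw [← Nat.cast_add, ZMod.natCast_eq_zero_iff_even]
      exact (hodd e hd).add_odd (hodd _ (Nat.div_dvd_of_dvd hd))
    · intro e he _ heq
      have hd := Nat.dvd_of_mem_divisors (Finset.mem_of_mem_erase he)
      have hmul := Nat.div_mul_cancel hd
      rw [heq] at hmul
      exact Finset.ne_of_mem_erase he (Nat.mul_self_inj.mp hmul)
    · intro e he
      have hd := Nat.dvd_of_mem_divisors (Finset.mem_of_mem_erase he)
      refine Finset.mem_erase.mpr ⟨fun heq => Finset.ne_of_mem_erase he ?_,
        Nat.mem_divisors.mpr ⟨Nat.div_dvd_of_dvd hd, mul_ne_zero hm0 hm0⟩⟩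
      have hmul := Nat.div_mul_cancel hd
      rw [heq] at hmul
      exact Nat.eq_of_mul_eq_mul_left hm.pos hmul
    · intro e he
      exact Nat.div_div_self (Nat.dvd_of_mem_divisors (Finset.mem_of_mem_erase he))
        (mul_ne_zero hm0 hm0)
  have hmem : m ∈ (m * m).divisors := Nat.mem_divisors.mpr ⟨dvd_mul_left m m, mul_ne_zero hm0 hm0⟩
  rw [← Finset.add_sum_erase _ _ hmem]
  refine hm.add_even ?_
  rwa [← ZMod.natCast_eq_zero_iff_even, Nat.cast_sum]

theorem odd_sum_divisors_two_pow (k : ℕ) : Odd (∑ e ∈ (2 ^ k).divisors, e) := by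
  rw [Nat.sum_divisors_prime_pow Nat.prime_two, Finset.sum_range_succ']
  exact Even.add_one (Finset.even_sum _ fun i _ => (even_two.pow_of_ne_zero i.succ_ne_zero))

theorem sum_divisors_eq_sum_midDivisors {n : ℕ} (hn : 1 < n) :
    ∑ d ∈ n.divisors, d = 1 + n + ∑ d ∈ midDivisors n, d := by
  have h : n.divisors = insert 1 (insert n (midDivisors n)) := by
    ext d
    simp only [midDivisors, Int.natAbs_natCast, Finset.mem_insert, Finset.mem_filter,
      Nat.mem_divisors]
    constructor
    · rintro ⟨hd, hn0⟩
      have := Nat.pos_of_dvd_of_pos hd (by omega)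
      have := Nat.le_of_dvd (by omega) hd
      have : d = 1 ∨ d = n ∨ (1 < d ∧ d < n) := by omega
      tauto
    · rintro (rfl | rfl | h)
      · exact ⟨one_dvd n, by omega⟩
      · exact ⟨dvd_rfl, by omega⟩
      · exact h.1
  rw [h, Finset.sum_insert, Finset.sum_insert, add_assoc]
  · simp [midDivisors]
  · simp [midDivisors, hn.ne]

theorem IsSPerfect.even_sum_divisors {n : ℕ} (hn : 1 < n) (h : IsSPerfect {-1, 1} (n : ℤ)) :
    Even (∑ d ∈ n.divisors, d) := by
  obtain ⟨-, lam, hlam, hsum⟩ := h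
  have hmod : (n : ZMod 2) = 1 + ∑ d ∈ midDivisors n, (d : ZMod 2) := by
    have hcast := congrArg (Int.cast : ℤ → ZMod 2) hsum
    push_cast at hcast
    rw [hcast]
    congr 1
    refine Finset.sum_congr rfl fun d hd => ?_
    rcases hlam d hd with h | h
    · simp [h, ZMod.neg_eq_self_mod_two]
    · rw [Set.mem_singleton_iff.mp h, Int.cast_one, one_mul]
  rw [sum_divisors_eq_sum_midDivisors hn, ← ZMod.natCast_eq_zero_iff_even]
  push_cast
  rw [add_right_comm, ← hmod, CharTwo.add_self_eq_zero]

theorem stmt19 :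
    (∀ n : ℕ, 1 < n → IsSPerfect {-1, 1} (n : ℤ) → Even (∑ d ∈ n.divisors, d)) ∧
    (∀ k d : ℕ, 1 ≤ d → Odd d → IsSPerfect {-1, 1} ((2 : ℤ) ^ k * d) → ¬ IsSquare d) := by
  refine ⟨fun n hn h => h.even_sum_divisors hn, ?_⟩
  rintro k d - hd h ⟨m, rfl⟩
  have hcast : (2 : ℤ) ^ k * ((m * m : ℕ) : ℤ) = ((2 ^ k * (m * m) : ℕ) : ℤ) := by push_cast; rfl
  rw [hcast] at h
  have heven := IsSPerfect.even_sum_divisors (by simpa only [Int.natAbs_natCast] using h.1) h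
  rw [Nat.Coprime.sum_divisors_mul (hd.coprime_two_left.pow_left k)] at heven
  exact Nat.not_even_iff_odd.mpr ((odd_sum_divisors_two_pow k).mul
    (odd_sum_divisors_mul_self (Nat.odd_mul.mp hd).1)) heven
end
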